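/- arXiv:math/0511573 — 5 statements merged into one kernel-verified Lean document; each statement's English description precedes it below -/
import Mathlib

section
/- Let f, g : ℤ_p → K be uniformly differentiable with derivatives f', g', and assume all twisted coefficients (f̂_{wq^{-1}})_q and (ĝ_{wq^{-1}})_q exist. Then for every x ∈ ℤ_p the limit defining (f *_q g)(x) = lim_{n→∞} Σ_{w ∈ C_{p^n}} (f̂_{wq^{-1}})_q (ĝ_{wq^{-1}})_q φ_{w^{-1}}(x) exists in K, and the resulting function f *_q g : ℤ_p → K is uniformly differentiable, i.e., there exists h : ℤ_p → K such that f *_q g is uniformly differentiable with derivative h. -/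
open Filter Topology

/-- The exponential power series `exp(x) = ∑ x^n / n!` in a normed field. -/
noncomputable def pExp {K : Type*} [NormedField K] (x : K) : K :=
  ∑' n : ℕ, (n.factorial : K)⁻¹ * x ^ n

/-- The embedding `ℤ_p ⊆ ℚ_p → K`. -/
noncomputable def emb {p : ℕ} [Fact p.Prime] {K : Type*} [NormedField K]
    [Algebra ℚ_[p] K] (x : ℤ_[p]) : K :=
  algebraMap ℚ_[p] K (x : ℚ_[p])

/-- `q^x := exp(x·L)` for `x ∈ ℤ_p`, where `q = exp L`. -/
noncomputable def qpow {p : ℕ} [Fact p.Prime] {K : Type*} [NormedField K]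
    [Algebra ℚ_[p] K] (L : K) (x : ℤ_[p]) : K :=
  pExp (emb x * L)

/-- `[p^N] = (1 - q^{p^N})/(1 - q)` where `q = exp L`. -/
noncomputable def qbracket (p : ℕ) [Fact p.Prime] {K : Type*} [NormedField K]
    [Algebra ℚ_[p] K] (L : K) (N : ℕ) : K :=
  (1 - qpow L ((p : ℤ_[p]) ^ N)) / (1 - pExp L)

/-- The `p`-adic `q`-integral `I_q(f)` exists and equals `I`. -/
def HasIq (p : ℕ) [Fact p.Prime] {K : Type*} [NormedField K] [Algebra ℚ_[p] K]
    (L : K) (f : ℤ_[p] → K) (I : K) : Prop :=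
  Tendsto (fun N : ℕ => (qbracket p L N)⁻¹ *
      ∑ x ∈ Finset.range (p ^ N), f (x : ℤ_[p]) * qpow L ((x : ℤ_[p]))) atTop (nhds I)

/-- `f` is uniformly differentiable with derivative `f'`. -/
def IsUnifDiff {p : ℕ} [Fact p.Prime] {K : Type*} [NormedField K] [Algebra ℚ_[p] K]
    (f f' : ℤ_[p] → K) : Prop :=
  ∀ ε : ℝ, 0 < ε → ∃ δ : ℝ, 0 < δ ∧ ∀ x y : ℤ_[p], 0 < ‖x - y‖ → ‖x - y‖ ≤ δ →
    ‖(f x - f y) / emb (x - y) - f' y‖ ≤ ε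

/-- `φ_w(x) = w^x̄` where `x̄` is the residue of `x` mod `p^n`. -/
noncomputable def phi {p : ℕ} [Fact p.Prime] {K : Type*} [NormedField K]
    (w : K) (n : ℕ) (x : ℤ_[p]) : K :=
  w ^ x.appr n

/-- The `p`-adic invariant integral `I_0(f)` exists and equals `I`. -/
def HasI0 (p : ℕ) [Fact p.Prime] {K : Type*} [NormedField K] [Algebra ℚ_[p] K]
    (f : ℤ_[p] → K) (I : K) : Prop :=
  Tendsto (fun N : ℕ => (algebraMap ℚ_[p] K ((p : ℚ_[p]) ^ N))⁻¹ *
      ∑ x ∈ Finset.range (p ^ N), f (x : ℤ_[p])) atTop (nhds I)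

section ExpPart
variable {p : ℕ} [Fact p.Prime] {K : Type*} [NormedField K] [Algebra ℚ_[p] K]

theorem normNat (hiso : ∀ x : ℚ_[p], ‖algebraMap ℚ_[p] K x‖ = ‖x‖) (n : ℕ) :
    ‖(n : K)‖ = ‖(n : ℚ_[p])‖ := by
  rw [← hiso, map_natCast]

theorem norm_fact_inv (hiso : ∀ x : ℚ_[p], ‖algebraMap ℚ_[p] K x‖ = ‖x‖) (n : ℕ) :
    ‖(n.factorial : K)⁻¹‖ ≤ ((p : ℝ) ^ (1 / ((p : ℝ) - 1))) ^ n := by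
  have hp : 1 < p := (Fact.out : p.Prime).one_lt
  have hp1 : (1 : ℝ) < p := by exact_mod_cast hp
  have hne : (n.factorial : ℚ_[p]) ≠ 0 := by exact_mod_cast n.factorial_ne_zero
  rw [norm_inv, normNat hiso, Padic.norm_eq_zpow_neg_valuation hne, Padic.valuation_natCast,
    zpow_neg, inv_inv, ← Real.rpow_natCast, ← Real.rpow_mul (by positivity), ← Real.rpow_intCast]
  apply Real.rpow_le_rpow_of_exponent_le hp1.le
  have h := sub_one_mul_padicValNat_factorial (p := p) n
  have h2 : (p - 1) * padicValNat p n.factorial ≤ n := by omega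
  have h3 : ((p : ℝ) - 1) * padicValNat p n.factorial ≤ n := by
    have : (((p - 1 : ℕ) : ℝ)) * padicValNat p n.factorial ≤ n := by exact_mod_cast h2
    rwa [Nat.cast_sub hp.le, Nat.cast_one] at this
  have h4 : (0 : ℝ) < p - 1 := by linarith
  rw [one_div, inv_mul_eq_div, le_div_iff₀ h4]
  have h5 : ((padicValNat p n.factorial : ℤ) : ℝ) = padicValNat p n.factorial := by simp only [Int.cast_natCast]
  rw [h5]
  linarith

theorem term_bound (hiso : ∀ x : ℚ_[p], ‖algebraMap ℚ_[p] K x‖ = ‖x‖) (L z : K) (t : ℝ)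
    (hz : ‖z‖ ≤ t * ‖L‖) (ht : 0 ≤ t) (n : ℕ) :
    ‖(n.factorial : K)⁻¹ * z ^ n‖ ≤ t ^ n * (‖L‖ * (p : ℝ) ^ (1 / ((p : ℝ) - 1))) ^ n := by
  rw [norm_mul, norm_pow]
  calc _ ≤ ((p : ℝ) ^ (1 / ((p : ℝ) - 1))) ^ n * (t * ‖L‖) ^ n := by
        gcongr
        exact norm_fact_inv hiso n
    _ = _ := by rw [mul_pow, mul_pow]; ring

theorem rho_lt (L : K) (hL1 : ‖L‖ < (p : ℝ) ^ (-1 / ((p : ℝ) - 1))) :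
    ‖L‖ * (p : ℝ) ^ (1 / ((p : ℝ) - 1)) < 1 := by
  have hp1 : (0 : ℝ) < p := by exact_mod_cast (Fact.out : p.Prime).pos
  have h : (0:ℝ) < (p : ℝ) ^ (1 / ((p : ℝ) - 1)) := Real.rpow_pos_of_pos hp1 _
  rw [neg_div, Real.rpow_neg hp1.le] at hL1
  calc _ < ((p : ℝ) ^ (1 / ((p : ℝ) - 1)))⁻¹ * (p : ℝ) ^ (1 / ((p : ℝ) - 1)) := by gcongr
    _ = 1 := inv_mul_cancel₀ h.ne'

theorem exp_summable (hiso : ∀ x : ℚ_[p], ‖algebraMap ℚ_[p] K x‖ = ‖x‖) (L z : K)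
    (hL1 : ‖L‖ < (p : ℝ) ^ (-1 / ((p : ℝ) - 1))) (hz : ‖z‖ ≤ ‖L‖) :
    Summable fun n : ℕ => ‖(n.factorial : K)⁻¹ * z ^ n‖ := by
  refine Summable.of_nonneg_of_le (fun _ => norm_nonneg _)
    (fun n => term_bound hiso L z 1 (by simpa using hz) zero_le_one n) ?_
  simp only [one_pow, one_mul]
  exact summable_geometric_of_lt_one (by positivity) (rho_lt L hL1)

theorem charZeroK (K : Type*) [NormedField K] [Algebra ℚ_[p] K] : CharZero K :=
  charZero_of_injective_algebraMap (algebraMap ℚ_[p] K).injective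

theorem exp_neg_mul [CompleteSpace K] (hiso : ∀ x : ℚ_[p], ‖algebraMap ℚ_[p] K x‖ = ‖x‖) (L z : K)
    (hL1 : ‖L‖ < (p : ℝ) ^ (-1 / ((p : ℝ) - 1))) (hz : ‖z‖ ≤ ‖L‖) :
    pExp (-z) * pExp z = 1 := by
  have : CharZero K := charZeroK (p := p) K
  unfold pExp
  rw [tsum_mul_tsum_eq_tsum_sum_antidiagonal_of_summable_norm
    (exp_summable hiso L (-z) hL1 (by simpa using hz)) (exp_summable hiso L z hL1 hz)]
  have : ∀ n : ℕ, ∑ kl ∈ Finset.HasAntidiagonal.antidiagonal n, ((kl.1.factorial : K)⁻¹ * (-z) ^ kl.1) *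
      ((kl.2.factorial : K)⁻¹ * z ^ kl.2) = if n = 0 then 1 else 0 := by
    intro n
    have h1 : (n.factorial : K) * ∑ kl ∈ Finset.HasAntidiagonal.antidiagonal n,
        ((kl.1.factorial : K)⁻¹ * (-z) ^ kl.1) * ((kl.2.factorial : K)⁻¹ * z ^ kl.2)
        = (-z + z) ^ n := by
      rw [(Commute.all (-z) z).add_pow', Finset.mul_sum]
      apply Finset.sum_congr rfl
      intro kl hkl
      rw [Finset.HasAntidiagonal.mem_antidiagonal] at hkl
      have := Nat.add_choose_mul_factorial_mul_factorial kl.1 kl.2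
      rw [hkl] at this
      rw [← this, nsmul_eq_mul]
      push_cast
      have a1 : (kl.1.factorial : K) ≠ 0 := by exact_mod_cast kl.1.factorial_ne_zero
      have a2 : (kl.2.factorial : K) ≠ 0 := by exact_mod_cast kl.2.factorial_ne_zero
      rw [Nat.choose_symm_of_eq_add (n := n) (a := kl.2) (b := kl.1) (by omega)]
      field_simp
    have hn : (n.factorial : K) ≠ 0 := by exact_mod_cast n.factorial_ne_zero
    rw [neg_add_cancel] at h1
    split_ifs with h0
    · subst h0; simp
    · rw [zero_pow h0] at h1
      exact (mul_eq_zero.mp h1).resolve_left hn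
  simp_rw [this]
  simp

theorem norm_emb (hiso : ∀ x : ℚ_[p], ‖algebraMap ℚ_[p] K x‖ = ‖x‖) (x : ℤ_[p]) :
    ‖(emb x : K)‖ = ‖x‖ := by
  rw [emb, hiso, PadicInt.norm_def]

theorem qpow_neg_mul [CompleteSpace K] (hiso : ∀ x : ℚ_[p], ‖algebraMap ℚ_[p] K x‖ = ‖x‖) (L : K)
    (hL1 : ‖L‖ < (p : ℝ) ^ (-1 / ((p : ℝ) - 1))) (x : ℤ_[p]) :
    qpow L (-x) * qpow L x = 1 := by
  unfold qpow
  have : (emb (-x) : K) * L = -(emb x * L) := by simp [emb]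
  rw [this]
  apply exp_neg_mul hiso L _ hL1
  rw [norm_mul, norm_emb hiso]
  have := PadicInt.norm_le_one x
  nlinarith [norm_nonneg L]

theorem normp (hiso : ∀ x : ℚ_[p], ‖algebraMap ℚ_[p] K x‖ = ‖x‖) : ‖(p : K)‖ = (p : ℝ)⁻¹ := by
  rw [normNat hiso]; simp

theorem exp_lim [CompleteSpace K] (hiso : ∀ x : ℚ_[p], ‖algebraMap ℚ_[p] K x‖ = ‖x‖) (L : K)
    (hL1 : ‖L‖ < (p : ℝ) ^ (-1 / ((p : ℝ) - 1))) :
    Tendsto (fun N : ℕ => ((p : K) ^ N)⁻¹ * (1 - qpow L ((p : ℤ_[p]) ^ N))) atTop (𝓝 (-L)) := by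
  have : CharZero K := charZeroK (p := p) K
  have hp0 : (0 : ℝ) < p := by exact_mod_cast (Fact.out : p.Prime).pos
  have hp1 : (1 : ℝ) < p := by exact_mod_cast (Fact.out : p.Prime).one_lt
  have hpK : (p : K) ≠ 0 := by exact_mod_cast (Fact.out : p.Prime).ne_zero
  set ρ := ‖L‖ * (p : ℝ) ^ (1 / ((p : ℝ) - 1)) with hρ
  have hρ0 : 0 ≤ ρ := by positivity
  have hρ1 : ρ < 1 := rho_lt L hL1
  rw [tendsto_iff_norm_sub_tendsto_zero]
  have key : ∀ N : ℕ, ‖((p : K) ^ N)⁻¹ * (1 - qpow L ((p : ℤ_[p]) ^ N)) - -L‖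
      ≤ ((p : ℝ)⁻¹) ^ N * ∑' n : ℕ, ρ ^ n := by
    intro N
    have he : (emb ((p : ℤ_[p]) ^ N) : K) = (p : K) ^ N := by simp [emb]
    set z := (p : K) ^ N * L with hz
    have hzn : ‖z‖ ≤ ((p : ℝ)⁻¹) ^ N * ‖L‖ := by
      rw [hz, norm_mul, norm_pow, normp hiso]
    have hzn1 : ‖z‖ ≤ ‖L‖ := hzn.trans (by
      have : ((p : ℝ)⁻¹) ^ N ≤ 1 := pow_le_one₀ (by positivity) (inv_le_one_of_one_le₀ hp1.le)
      nlinarith [norm_nonneg L])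
    have hs := exp_summable hiso L z hL1 hzn1
    have h2 := hs.of_norm.sum_add_tsum_nat_add 2
    have hq : qpow L ((p : ℤ_[p]) ^ N) = 1 + z +
        ∑' n : ℕ, ((n + 2).factorial : K)⁻¹ * z ^ (n + 2) := by
      unfold qpow pExp
      rw [he, ← h2]
      simp [Finset.sum_range_succ]
    have hb : ‖∑' n : ℕ, ((n + 2).factorial : K)⁻¹ * z ^ (n + 2)‖ ≤
        ((p : ℝ)⁻¹ ^ N) ^ 2 * ∑' n : ℕ, ρ ^ n := by
      rw [← tsum_mul_left]
      apply tsum_of_norm_bounded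
      · exact ((summable_geometric_of_lt_one hρ0 hρ1).mul_left _).hasSum
      · intro n
        refine (term_bound hiso L z _ hzn (by positivity) (n + 2)).trans ?_
        have : ((p : ℝ)⁻¹) ^ N ≤ 1 := pow_le_one₀ (by positivity) (inv_le_one_of_one_le₀ hp1.le)
        apply mul_le_mul
        · exact pow_le_pow_of_le_one (by positivity) this (by omega)
        · exact pow_le_pow_of_le_one hρ0 hρ1.le (by omega)
        · positivity
        · positivity
    have : ((p : K) ^ N)⁻¹ * (1 - qpow L ((p : ℤ_[p]) ^ N)) - -L = -(((p : K) ^ N)⁻¹ *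
        ∑' n : ℕ, ((n + 2).factorial : K)⁻¹ * z ^ (n + 2)) := by
      rw [hq, hz]
      field_simp
      ring
    rw [this, norm_neg, norm_mul, norm_inv, norm_pow, normp hiso]
    calc _ ≤ (((p : ℝ)⁻¹ ^ N))⁻¹ * (((p : ℝ)⁻¹ ^ N) ^ 2 * ∑' n : ℕ, ρ ^ n) := by gcongr
      _ = _ := by
        have : ((p : ℝ)⁻¹ ^ N) ≠ 0 := by positivity
        field_simp
  refine squeeze_zero (fun _ => norm_nonneg _) key ?_
  have := (tendsto_pow_atTop_nhds_zero_of_lt_one (r := (p : ℝ)⁻¹) (by positivity)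
    (inv_lt_one_of_one_lt₀ hp1)).mul_const (∑' n : ℕ, ρ ^ n)
  simpa using this

/-- `[p^N]⁻¹ p^N` converges -/
theorem qb_lim [CompleteSpace K] (hiso : ∀ x : ℚ_[p], ‖algebraMap ℚ_[p] K x‖ = ‖x‖) (L : K)
    (hL0 : 0 < ‖L‖) (hL1 : ‖L‖ < (p : ℝ) ^ (-1 / ((p : ℝ) - 1))) :
    Tendsto (fun N : ℕ => (qbracket p L N)⁻¹ * (p : K) ^ N) atTop
      (𝓝 ((-L)⁻¹ * (1 - pExp L))) := by
  have h := ((exp_lim hiso L hL1).inv₀ (by simpa using hL0)).mul_const (1 - pExp L)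
  refine h.congr ?_
  intro N
  unfold qbracket
  rw [inv_div, mul_inv, inv_inv]
  ring
end ExpPart


/-- bounded Lipschitz functions -/
def LipB {p : ℕ} [Fact p.Prime] {K : Type*} [NormedField K] (M : ℝ) (f : ℤ_[p] → K) : Prop :=
  (∀ x, ‖f x‖ ≤ M) ∧ ∀ x y, ‖f x - f y‖ ≤ M * ‖x - y‖

/-- finite Fourier coefficient -/
noncomputable def FF {p : ℕ} [Fact p.Prime] {K : Type*} [NormedField K] (n : ℕ) (f : ℤ_[p] → K)
    (w : K) : K :=
  ((p : K) ^ n)⁻¹ * ∑ y ∈ Finset.range (p ^ n), f (y : ℤ_[p]) * w ^ y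

open Classical in
/-- finite convolution -/
noncomputable def AA {p : ℕ} [Fact p.Prime] {K : Type*} [NormedField K] (n : ℕ)
    (f g : ℤ_[p] → K) (x : ℤ_[p]) : K :=
  ((p : K) ^ n)⁻¹ * ∑ y ∈ Finset.range (p ^ n), ∑ z ∈ Finset.range (p ^ n),
    if (p : ℤ_[p]) ^ n ∣ x - y - z then f (y : ℤ_[p]) * g (z : ℤ_[p]) else 0

/-- rescaled function -/
noncomputable def SC {p : ℕ} [Fact p.Prime] {K : Type*} [NormedField K] (m : ℕ)
    (f : ℤ_[p] → K) (a : ℕ) (s : ℤ_[p]) : K :=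
  ((p : K) ^ m)⁻¹ * (f ((a : ℤ_[p]) + (p : ℤ_[p]) ^ m * s) - f (a : ℤ_[p]))

open Classical in
/-- exact quotient -/
noncomputable def qt {p : ℕ} [Fact p.Prime] (m : ℕ) (x : ℤ_[p]) : ℤ_[p] :=
  if h : (p : ℤ_[p]) ^ m ∣ x then h.choose else 0

section FinPart
variable {p : ℕ} [Fact p.Prime] {K : Type*} [NormedField K]

theorem qt_spec {m : ℕ} {x : ℤ_[p]} (h : (p : ℤ_[p]) ^ m ∣ x) : (p : ℤ_[p]) ^ m * qt m x = x := by
  unfold qt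
  rw [dif_pos h]
  exact h.choose_spec.symm

theorem sum_range_split {M : Type*} [AddCommMonoid M] (P Q : ℕ) (φ : ℕ → M) :
    ∑ y ∈ Finset.range (P * Q), φ y =
      ∑ a ∈ Finset.range P, ∑ s ∈ Finset.range Q, φ (a + P * s) := by
  induction Q with
  | zero => simp
  | succ Q ih =>
    rw [Nat.mul_succ, Finset.sum_range_add, ih]
    simp_rw [Finset.sum_range_succ]
    rw [Finset.sum_add_distrib]
    congr 1
    exact Finset.sum_congr rfl fun a _ => by rw [add_comm]

theorem pdvd_norm {n : ℕ} {x : ℤ_[p]} : (p : ℤ_[p]) ^ n ∣ x ↔ ‖x‖ ≤ ((p : ℝ)⁻¹) ^ n := by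
  have := PadicInt.norm_le_pow_iff_mem_span_pow x n
  rw [Ideal.mem_span_singleton] at this
  rw [← this]
  simp

theorem norm_pp (n : ℕ) : ‖(p : ℤ_[p]) ^ n‖ = ((p : ℝ)⁻¹) ^ n := by simp

theorem exists_uniq_z (n : ℕ) (x : ℤ_[p]) : ∃ z0 ∈ Finset.range (p ^ n),
    ∀ z ∈ Finset.range (p ^ n), ((p : ℤ_[p]) ^ n ∣ x - z ↔ z = z0) := by
  refine ⟨x.appr n, Finset.mem_range.2 (PadicInt.appr_lt x n), fun z hz => ?_⟩
  have h1 : (p : ℤ_[p]) ^ n ∣ x - (x.appr n : ℕ) :=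
    Ideal.mem_span_singleton.1 (PadicInt.appr_spec n x)
  constructor
  · intro h2
    have h3 : (p : ℤ_[p]) ^ n ∣ (((x.appr n : ℤ) - (z : ℤ) : ℤ) : ℤ_[p]) := by
      have := dvd_sub h2 h1
      push_cast
      convert this using 1
      ring
    rw [PadicInt.pow_p_dvd_int_iff] at h3
    have hz' := Finset.mem_range.1 hz
    have ha := PadicInt.appr_lt x n
    have : (x.appr n : ℤ) - z = 0 := by
      apply Int.eq_zero_of_abs_lt_dvd h3
      rw [abs_lt]
      have e1 : (z : ℤ) < (p : ℤ) ^ n := by exact_mod_cast hz'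
      have e2 : (x.appr n : ℤ) < (p : ℤ) ^ n := by exact_mod_cast ha
      constructor <;> omega
    omega
  · rintro rfl
    exact h1

theorem AA_comm (n : ℕ) (f g : ℤ_[p] → K) (x : ℤ_[p]) : AA n f g x = AA n g f x := by
  unfold AA
  rw [Finset.sum_comm]
  congr 1
  refine Finset.sum_congr rfl fun y _ => Finset.sum_congr rfl fun z _ => ?_
  rw [sub_right_comm, mul_comm]

theorem AA_add_left (n : ℕ) (f1 f2 g : ℤ_[p] → K) (x : ℤ_[p]) :
    AA n (fun s => f1 s + f2 s) g x = AA n f1 g x + AA n f2 g x := by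
  unfold AA
  rw [← mul_add, ← Finset.sum_add_distrib]
  congr 1
  refine Finset.sum_congr rfl fun y _ => ?_
  rw [← Finset.sum_add_distrib]
  refine Finset.sum_congr rfl fun z _ => ?_
  split_ifs <;> ring

theorem AA_smul_left (n : ℕ) (c : K) (f g : ℤ_[p] → K) (x : ℤ_[p]) :
    AA n (fun s => c * f s) g x = c * AA n f g x := by
  unfold AA
  rw [mul_left_comm, Finset.mul_sum (a := c)]
  congr 1
  refine Finset.sum_congr rfl fun y _ => ?_
  rw [Finset.mul_sum]
  refine Finset.sum_congr rfl fun z _ => ?_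
  split_ifs <;> ring

theorem AA_add_right (n : ℕ) (g f1 f2 : ℤ_[p] → K) (x : ℤ_[p]) :
    AA n g (fun s => f1 s + f2 s) x = AA n g f1 x + AA n g f2 x := by
  rw [AA_comm, AA_add_left, AA_comm n f1, AA_comm n f2]

theorem AA_smul_right (n : ℕ) (c : K) (f g : ℤ_[p] → K) (x : ℤ_[p]) :
    AA n f (fun s => c * g s) x = c * AA n f g x := by
  rw [AA_comm, AA_smul_left, AA_comm]

theorem AA_const_right (n : ℕ) (c : K) (f : ℤ_[p] → K) (x : ℤ_[p]) :
    AA n f (fun _ => c) x = c * FF n f 1 := by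
  unfold AA FF
  rw [mul_left_comm, Finset.mul_sum (a := c)]
  congr 1
  refine Finset.sum_congr rfl fun y _ => ?_
  obtain ⟨z0, h0, h1⟩ := exists_uniq_z n (x - (y : ℤ_[p]))
  rw [Finset.sum_eq_single z0]
  · rw [if_pos ((h1 z0 h0).2 rfl)]; simp; ring
  · intro b hb hne
    rw [if_neg (fun h => hne ((h1 b hb).1 h))]
  · exact fun h => absurd h0 h

theorem AA_const_left (n : ℕ) (c : K) (f : ℤ_[p] → K) (x : ℤ_[p]) :
    AA n (fun _ => c) f x = c * FF n f 1 := by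
  rw [AA_comm, AA_const_right]

theorem FF_const [CharZero K] (n : ℕ) (c : K) : FF (p := p) n (fun _ => c) 1 = c := by
  have hpK : (p : K) ≠ 0 := by exact_mod_cast (Fact.out : p.Prime).ne_zero
  unfold FF
  simp
  field_simp

theorem SC_eq [CharZero K] (m : ℕ) (f : ℤ_[p] → K) (a : ℕ) :
    (fun s => f ((a : ℤ_[p]) + (p : ℤ_[p]) ^ m * s)) =
      fun s => f (a : ℤ_[p]) + (p : K) ^ m * SC m f a s := by
  have hpK : (p : K) ≠ 0 := by exact_mod_cast (Fact.out : p.Prime).ne_zero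
  funext s
  unfold SC
  field_simp
  ring

open Classical in
theorem AA_split (m k : ℕ) (f g : ℤ_[p] → K) (x : ℤ_[p]) :
    AA (m + k) f g x = ((p : K) ^ m)⁻¹ * ∑ a ∈ Finset.range (p ^ m), ∑ b ∈ Finset.range (p ^ m),
      if (p : ℤ_[p]) ^ m ∣ x - a - b then
        AA k (fun s => f ((a : ℤ_[p]) + (p : ℤ_[p]) ^ m * s))
          (fun s => g ((b : ℤ_[p]) + (p : ℤ_[p]) ^ m * s)) (qt m (x - (a : ℤ_[p]) - (b : ℤ_[p]))) else 0 := by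
  have hp0 : ((p : ℤ_[p]) ^ m) ≠ 0 :=
    pow_ne_zero _ (by exact_mod_cast (Fact.out : p.Prime).ne_zero)
  have hcond : ∀ a b s t : ℕ, ((p : ℤ_[p]) ^ (m + k) ∣ x - ((a + p ^ m * s : ℕ) : ℤ_[p]) -
      ((b + p ^ m * t : ℕ) : ℤ_[p])) ↔ ((p : ℤ_[p]) ^ m ∣ x - a - b ∧
        (p : ℤ_[p]) ^ k ∣ qt m (x - (a : ℤ_[p]) - (b : ℤ_[p])) - s - t) := by
    intro a b s t
    have e : x - ((a + p ^ m * s : ℕ) : ℤ_[p]) - ((b + p ^ m * t : ℕ) : ℤ_[p]) =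
        (x - a - b) - (p : ℤ_[p]) ^ m * (s + t) := by push_cast; ring
    rw [e]
    constructor
    · intro h
      have h1 : (p : ℤ_[p]) ^ m ∣ x - a - b := by
        have := dvd_add ((Dvd.intro _ (pow_add _ m k).symm).trans h)
          (Dvd.intro ((s : ℤ_[p]) + t) (rfl : (p : ℤ_[p]) ^ m * (s + t) = _))
        simpa using this
      refine ⟨h1, ?_⟩
      rw [← qt_spec h1, ← mul_sub, pow_add] at h
      have := (mul_dvd_mul_iff_left hp0).1 h
      rwa [sub_sub]
    · rintro ⟨h1, h2⟩
      nth_rewrite 1 [← qt_spec h1]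
      rw [← mul_sub, pow_add, ← sub_sub]
      exact mul_dvd_mul_left _ h2
  unfold AA
  rw [pow_add, pow_add, mul_inv, mul_assoc, sum_range_split]
  simp_rw [sum_range_split, hcond]
  congr 1
  rw [Finset.mul_sum]
  refine Finset.sum_congr rfl fun a _ => ?_
  rw [Finset.sum_comm, Finset.mul_sum]
  refine Finset.sum_congr rfl fun b _ => ?_
  split_ifs with h
  · simp [h]
  · simp [h]

open Classical in
theorem AA_star [CharZero K] (m k : ℕ) (f g : ℤ_[p] → K) (x : ℤ_[p]) :
    AA (m + k) f g x = ((p : K) ^ m)⁻¹ * ∑ a ∈ Finset.range (p ^ m), ∑ b ∈ Finset.range (p ^ m),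
      if (p : ℤ_[p]) ^ m ∣ x - a - b then
        (f a * FF k (fun s => g ((b : ℤ_[p]) + (p : ℤ_[p]) ^ m * s)) 1
        + g b * FF k (fun s => f ((a : ℤ_[p]) + (p : ℤ_[p]) ^ m * s)) 1 - f a * g b
        + (p : K) ^ m * ((p : K) ^ m * AA k (SC m f a) (SC m g b) (qt m (x - (a : ℤ_[p]) - (b : ℤ_[p]))))) else 0 := by
  rw [AA_split]
  congr 1
  refine Finset.sum_congr rfl fun a _ => Finset.sum_congr rfl fun b _ => ?_
  split_ifs
  · have hF : ∀ (u : K) (h : ℤ_[p] → K), FF k (fun s => u + (p : K) ^ m * h s) 1 =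
        u + (p : K) ^ m * FF k h 1 := by
      intro u h
      have h1 := AA_const_left (p := p) k 1 (fun s => u + (p : K) ^ m * h s) 0
      rw [AA_add_right, AA_smul_right, AA_const_left, AA_const_left, FF_const] at h1
      simpa using h1.symm
    rw [SC_eq m f a, SC_eq m g b, hF, hF, AA_add_left, AA_const_left, hF, AA_smul_left,
      AA_add_right, AA_const_right, AA_smul_right]
    ring
  · rfl

theorem SC_lip [Algebra ℚ_[p] K] (hiso : ∀ x : ℚ_[p], ‖algebraMap ℚ_[p] K x‖ = ‖x‖)
    {M : ℝ} (hM : 0 ≤ M) (m : ℕ) (f : ℤ_[p] → K) (hf : LipB M f) (a : ℕ) : LipB M (SC m f a) := by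
  have hp0 : (0 : ℝ) < p := by exact_mod_cast (Fact.out : p.Prime).pos
  have key : ∀ x y, ‖SC m f a x - SC m f a y‖ ≤ M * ‖x - y‖ := by
    intro x y
    have : SC m f a x - SC m f a y = ((p : K) ^ m)⁻¹ * (f ((a : ℤ_[p]) + (p : ℤ_[p]) ^ m * x) -
      f ((a : ℤ_[p]) + (p : ℤ_[p]) ^ m * y)) := by unfold SC; ring
    rw [this, norm_mul, norm_inv, norm_pow, normp hiso]
    have h1 := hf.2 ((a : ℤ_[p]) + (p : ℤ_[p]) ^ m * x) ((a : ℤ_[p]) + (p : ℤ_[p]) ^ m * y)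
    rw [add_sub_add_left_eq_sub, ← mul_sub, norm_mul, norm_pp] at h1
    calc _ ≤ (((p : ℝ)⁻¹) ^ m)⁻¹ * (M * (((p : ℝ)⁻¹) ^ m * ‖x - y‖)) := by gcongr
      _ = _ := by
        have : ((p : ℝ)⁻¹) ^ m ≠ 0 := by positivity
        field_simp
  refine ⟨fun x => ?_, key⟩
  have h := key x 0
  have h0 : SC m f a 0 = 0 := by simp [SC]
  rw [h0, sub_zero, sub_zero] at h
  exact h.trans (mul_le_of_le_one_right hM (PadicInt.norm_le_one x))

theorem norm_rootpow {w : K} {n : ℕ} (hw : w ^ p ^ n = 1) : ‖w‖ = 1 := by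
  have h : ‖w‖ ^ p ^ n = 1 := by rw [← norm_pow, hw, norm_one]
  exact (pow_eq_one_iff_of_nonneg (norm_nonneg _)
    (pow_ne_zero _ (Fact.out : p.Prime).ne_zero)).1 h

theorem geom_root {ζ : K} (h : ζ ^ p = 1) : ∑ j ∈ Finset.range p, ζ ^ j = 0 ∨
    ∑ j ∈ Finset.range p, ζ ^ j = p := by
  by_cases h1 : ζ = 1
  · right; simp [h1]
  · left
    rw [geom_sum_eq h1, h]; simp

theorem FF_bound [IsUltrametricDist K] [Algebra ℚ_[p] K]
    (hiso : ∀ x : ℚ_[p], ‖algebraMap ℚ_[p] K x‖ = ‖x‖)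
    {M : ℝ} (hM : 0 ≤ M) (f : ℤ_[p] → K) (hf : LipB M f) (n : ℕ) :
    ∀ w : K, w ^ p ^ n = 1 → ‖FF n f w‖ ≤ p * M := by
  have : CharZero K := charZeroK (p := p) K
  have hpK : (p : K) ≠ 0 := by exact_mod_cast (Fact.out : p.Prime).ne_zero
  have hp0 : (0 : ℝ) < p := by exact_mod_cast (Fact.out : p.Prime).pos
  have hp1 : (1 : ℝ) ≤ p := by exact_mod_cast (Fact.out : p.Prime).one_le
  induction n with
  | zero =>
    intro w hw
    simp only [FF, pow_zero, inv_one, one_mul, Finset.range_one, Finset.sum_singleton, mul_one]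
    exact (hf.1 _).trans (le_mul_of_one_le_left hM hp1)
  | succ n ih =>
    intro w hw
    have hw1 := norm_rootpow hw
    have hζ : (w ^ p ^ n) ^ p = 1 := by rw [← pow_mul, ← pow_succ, hw]
    have e : FF (n + 1) f w = ((p : K) ^ (n + 1))⁻¹ * (∑ a ∈ Finset.range (p ^ n),
        ∑ j ∈ Finset.range p, (f ((a + p ^ n * j : ℕ) : ℤ_[p]) - f (a : ℤ_[p])) *
          w ^ (a + p ^ n * j)) +
        (p : K)⁻¹ * (∑ j ∈ Finset.range p, (w ^ p ^ n) ^ j) * FF n f w := by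
      unfold FF
      rw [pow_succ p n, sum_range_split]
      have : ∑ a ∈ Finset.range (p ^ n), ∑ j ∈ Finset.range p,
          f ((a + p ^ n * j : ℕ) : ℤ_[p]) * w ^ (a + p ^ n * j) =
          ∑ a ∈ Finset.range (p ^ n),
        ∑ j ∈ Finset.range p, (f ((a + p ^ n * j : ℕ) : ℤ_[p]) - f (a : ℤ_[p])) *
          w ^ (a + p ^ n * j) + (∑ j ∈ Finset.range p, (w ^ p ^ n) ^ j) *
          ∑ a ∈ Finset.range (p ^ n), f (a : ℤ_[p]) * w ^ a := by
        rw [Finset.mul_sum, ← Finset.sum_add_distrib]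
        refine Finset.sum_congr rfl fun a _ => ?_
        rw [Finset.sum_mul, ← Finset.sum_add_distrib]
        refine Finset.sum_congr rfl fun j _ => ?_
        rw [pow_add, pow_mul]
        ring
      rw [this, pow_succ, mul_inv]
      ring
    rw [e]
    refine (IsUltrametricDist.norm_add_le_max _ _).trans (max_le ?_ ?_)
    · rw [norm_mul, norm_inv, norm_pow, normp hiso]
      have : ‖∑ a ∈ Finset.range (p ^ n),
        ∑ j ∈ Finset.range p, (f ((a + p ^ n * j : ℕ) : ℤ_[p]) - f (a : ℤ_[p])) *
          w ^ (a + p ^ n * j)‖ ≤ M * ((p : ℝ)⁻¹) ^ n := by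
        refine IsUltrametricDist.norm_sum_le_of_forall_le_of_nonneg (by positivity) fun a _ => ?_
        refine IsUltrametricDist.norm_sum_le_of_forall_le_of_nonneg (by positivity) fun j _ => ?_
        rw [norm_mul, norm_pow, hw1, one_pow, mul_one]
        refine (hf.2 _ _).trans ?_
        gcongr
        have e : (((a + p ^ n * j : ℕ) : ℤ_[p]) - (a : ℤ_[p])) = (p : ℤ_[p]) ^ n * j := by
          push_cast; ring
        rw [e, norm_mul, norm_pp]
        exact mul_le_of_le_one_right (by positivity) (PadicInt.norm_le_one _)
      calc _ ≤ (((p : ℝ)⁻¹) ^ (n + 1))⁻¹ * (M * ((p : ℝ)⁻¹) ^ n) := by gcongr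
        _ = p * M := by
          rw [pow_succ]
          have : ((p : ℝ)⁻¹) ^ n ≠ 0 := by positivity
          field_simp
    · rcases geom_root hζ with h | h
      · rw [h]; simp; positivity
      · rw [h, inv_mul_cancel₀ hpK, one_mul]
        apply ih
        by_contra hne
        rw [geom_sum_eq hne, hζ] at h
        simp at h
        exact hpK h.symm
end FinPart


/-- division-free uniform differentiability -/
def UDm {p : ℕ} [Fact p.Prime] {K : Type*} [NormedField K] [Algebra ℚ_[p] K]
    (f f' : ℤ_[p] → K) (ε : ℝ) (m : ℕ) : Prop :=
  ∀ x y : ℤ_[p], (p : ℤ_[p]) ^ m ∣ x - y → ‖f x - f y - f' y * emb (x - y)‖ ≤ ε * ‖x - y‖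

section P3
variable {p : ℕ} [Fact p.Prime] {K : Type*} [NormedField K]

theorem geom_root' {K : Type*} [NormedField K] {P : ℕ} {ζ : K} (h : ζ ^ P = 1) :
    ∑ j ∈ Finset.range P, ζ ^ j = 0 ∨ ∑ j ∈ Finset.range P, ζ ^ j = P := by
  by_cases h1 : ζ = 1
  · right; simp [h1]
  · left
    rw [geom_sum_eq h1, h]; simp

theorem orth (C : ℕ → Finset K) (hC : ∀ n : ℕ, ∀ w : K, w ∈ C n ↔ w ^ p ^ n = 1)
    (hCcard : ∀ n : ℕ, (C n).card = p ^ n) (n k : ℕ) :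
    ∑ w ∈ C n, w ^ k = if p ^ n ∣ k then (p : K) ^ n else 0 := by
  have hp : p.Prime := Fact.out
  split_ifs with h
  · obtain ⟨j, rfl⟩ := h
    rw [Finset.sum_congr rfl (g := fun _ => (1 : K))]
    · simp [hCcard]
    · intro w hw
      rw [pow_mul, (hC n w).1 hw, one_pow]
  · have hex : ∃ w0 ∈ C n, w0 ^ k ≠ 1 := by
      by_contra! hcon
      obtain ⟨j, hj, hg⟩ := (Nat.dvd_prime_pow hp).1 (Nat.gcd_dvd_right k (p ^ n))
      have hjn : j < n := by
        refine lt_of_le_of_ne hj ?_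
        rintro rfl
        exact h (hg ▸ Nat.gcd_dvd_left k (p ^ j))
      have hsub : C n ⊆ C j := by
        intro w hw
        rw [hC, ← hg]
        exact pow_gcd_eq_one.2 ⟨hcon w hw, (hC n w).1 hw⟩
      have := Finset.card_le_card hsub
      rw [hCcard, hCcard] at this
      exact absurd this (not_le.2 (Nat.pow_lt_pow_right hp.one_lt hjn))
    obtain ⟨w0, hw0, hne⟩ := hex
    have hw0' := (hC n w0).1 hw0
    have hw00 : w0 ≠ 0 := by
      rintro rfl
      rw [zero_pow (pow_ne_zero _ hp.ne_zero)] at hw0'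
      exact zero_ne_one hw0'
    have : ∑ w ∈ C n, w ^ k = w0 ^ k * ∑ w ∈ C n, w ^ k := by
      rw [Finset.mul_sum]
      refine Finset.sum_bij' (fun w _ => w0⁻¹ * w) (fun w _ => w0 * w) ?_ ?_ ?_ ?_ ?_
      · intro w hw
        rw [hC, mul_pow, inv_pow, hw0', (hC n w).1 hw]; simp
      · intro w hw
        rw [hC, mul_pow, hw0', (hC n w).1 hw]; simp
      · intro w _; field_simp
      · intro w _; field_simp
      · intro w _; rw [mul_pow, inv_pow]; field_simp
    have h2 : (w0 ^ k - 1) * ∑ w ∈ C n, w ^ k = 0 := by rw [sub_mul, ← this]; ring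
    exact (mul_eq_zero.1 h2).resolve_left (sub_ne_zero.2 hne)

theorem AA_fourier [CharZero K] (C : ℕ → Finset K)
    (hC : ∀ n : ℕ, ∀ w : K, w ∈ C n ↔ w ^ p ^ n = 1)
    (hCcard : ∀ n : ℕ, (C n).card = p ^ n) (n : ℕ) (f g : ℤ_[p] → K) (x : ℤ_[p]) :
    AA n f g x = ∑ w ∈ C n, FF n f w * FF n g w * phi w⁻¹ n x := by
  classical
  have hp : p.Prime := Fact.out
  have hpK : (p : K) ≠ 0 := by exact_mod_cast hp.ne_zero
  have hpn : 1 ≤ p ^ n := Nat.one_le_pow _ _ hp.pos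
  have h1 : (p : ℤ_[p]) ^ n ∣ x - (x.appr n : ℕ) :=
    Ideal.mem_span_singleton.1 (PadicInt.appr_spec n x)
  have e : ∀ w ∈ C n, FF n f w * FF n g w * phi w⁻¹ n x = ((p : K) ^ n)⁻¹ * ((p : K) ^ n)⁻¹ *
      ∑ y ∈ Finset.range (p ^ n), ∑ z ∈ Finset.range (p ^ n),
        f (y : ℤ_[p]) * g (z : ℤ_[p]) * w ^ (y + z + (p ^ n - 1) * x.appr n) := by
    intro w hw
    have hw' := (hC n w).1 hw
    have hw0 : w ≠ 0 := by
      rintro rfl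
      rw [zero_pow (pow_ne_zero _ hp.ne_zero)] at hw'
      exact zero_ne_one hw'
    have hinv : w⁻¹ = w ^ (p ^ n - 1) := by
      apply inv_eq_of_mul_eq_one_right
      rw [← pow_succ', Nat.sub_add_cancel hpn, hw']
    unfold FF phi
    rw [hinv, ← pow_mul, mul_mul_mul_comm, Finset.sum_mul_sum, mul_assoc, Finset.sum_mul]
    congr 1
    refine Finset.sum_congr rfl fun y _ => ?_
    rw [Finset.sum_mul]
    refine Finset.sum_congr rfl fun z _ => ?_
    rw [pow_add, pow_add]
    ring
  rw [Finset.sum_congr rfl e, ← Finset.mul_sum, Finset.sum_comm]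
  unfold AA
  rw [mul_assoc]
  congr 1
  rw [Finset.mul_sum]
  refine Finset.sum_congr rfl fun y _ => ?_
  rw [Finset.sum_comm, Finset.mul_sum]
  refine Finset.sum_congr rfl fun z _ => ?_
  rw [← Finset.mul_sum, orth C hC hCcard]
  have hiff : (p : ℤ_[p]) ^ n ∣ x - y - z ↔ p ^ n ∣ y + z + (p ^ n - 1) * x.appr n := by
    have h2 : p ^ n ∣ y + z + (p ^ n - 1) * x.appr n ↔
        (p : ℤ_[p]) ^ n ∣ ((y + z + (p ^ n - 1) * x.appr n : ℕ) : ℤ_[p]) := by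
      have := PadicInt.pow_p_dvd_int_iff (p := p) n ((y + z + (p ^ n - 1) * x.appr n : ℕ) : ℤ)
      rw [Int.cast_natCast] at this
      rw [this]
      exact_mod_cast Iff.rfl
    rw [h2]
    have h3 : ((y + z + (p ^ n - 1) * x.appr n : ℕ) : ℤ_[p]) =
      -(x - y - z) + ((x - (x.appr n : ℕ)) + (p : ℤ_[p]) ^ n * x.appr n) := by
      rw [Nat.cast_add, Nat.cast_mul, Nat.cast_sub hpn]
      push_cast
      ring
    rw [h3, dvd_add_left (dvd_add h1 (dvd_mul_right _ _)), dvd_neg]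
  by_cases h : (p : ℤ_[p]) ^ n ∣ x - y - z
  · rw [if_pos h, if_pos (hiff.1 h)]
    have : (p : K) ^ n ≠ 0 := pow_ne_zero _ hpK
    field_simp
  · rw [if_neg h, if_neg (fun hh => h (hiff.2 hh))]
    simp

theorem norm_phi {w : K} {n : ℕ} (hw : w ^ p ^ n = 1) (k : ℕ) (x : ℤ_[p]) :
    ‖phi w⁻¹ k x‖ = 1 := by
  unfold phi
  rw [norm_pow, norm_inv, norm_rootpow hw]; simp

theorem AA_sup [IsUltrametricDist K] [Algebra ℚ_[p] K]
    (hiso : ∀ x : ℚ_[p], ‖algebraMap ℚ_[p] K x‖ = ‖x‖) (C : ℕ → Finset K)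
    (hC : ∀ n : ℕ, ∀ w : K, w ∈ C n ↔ w ^ p ^ n = 1)
    (hCcard : ∀ n : ℕ, (C n).card = p ^ n) (n : ℕ) {f g : ℤ_[p] → K} {M M' : ℝ}
    (hM : 0 ≤ M) (hM' : 0 ≤ M') (hf : LipB M f) (hg : LipB M' g) (x : ℤ_[p]) :
    ‖AA n f g x‖ ≤ (p * M) * (p * M') := by
  have : CharZero K := charZeroK (p := p) K
  rw [AA_fourier C hC hCcard]
  refine IsUltrametricDist.norm_sum_le_of_forall_le_of_nonneg (by positivity) fun w hw => ?_
  have hw' := (hC n w).1 hw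
  rw [norm_mul, norm_mul, norm_phi hw', mul_one]
  have := FF_bound hiso hM f hf n w hw'
  have := FF_bound hiso hM' g hg n w hw'
  gcongr

theorem cond_iff {m : ℕ} {x x' : ℤ_[p]} (h : (p : ℤ_[p]) ^ m ∣ x - x') (a b : ℤ_[p]) :
    (p : ℤ_[p]) ^ m ∣ x - a - b ↔ (p : ℤ_[p]) ^ m ∣ x' - a - b := by
  have : x - a - b = (x' - a - b) + (x - x') := by ring
  rw [this, dvd_add_left h]

theorem AA_congr {n : ℕ} {x x' : ℤ_[p]} (h : (p : ℤ_[p]) ^ n ∣ x - x') (f g : ℤ_[p] → K) :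
    AA n f g x = AA n f g x' := by
  classical
  unfold AA
  simp_rw [cond_iff h]

open Classical in
theorem AA_diff [CharZero K] (m k : ℕ) (f g : ℤ_[p] → K) {x x' : ℤ_[p]}
    (h : (p : ℤ_[p]) ^ m ∣ x - x') :
    AA (m + k) f g x - AA (m + k) f g x' = (p : K) ^ m *
      ∑ a ∈ Finset.range (p ^ m), ∑ b ∈ Finset.range (p ^ m),
      if (p : ℤ_[p]) ^ m ∣ x' - a - b then
        AA k (SC m f a) (SC m g b) (qt m (x - (a : ℤ_[p]) - (b : ℤ_[p])))
        - AA k (SC m f a) (SC m g b) (qt m (x' - (a : ℤ_[p]) - (b : ℤ_[p]))) else 0 := by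
  have hpK : (p : K) ≠ 0 := by exact_mod_cast (Fact.out : p.Prime).ne_zero
  have hpm : (p : K) ^ m ≠ 0 := pow_ne_zero _ hpK
  rw [AA_star, AA_star, ← mul_sub, ← Finset.sum_sub_distrib]
  simp_rw [← Finset.sum_sub_distrib, cond_iff h]
  rw [inv_mul_eq_iff_eq_mul₀ hpm, Finset.mul_sum, Finset.mul_sum]
  refine Finset.sum_congr rfl fun a _ => ?_
  rw [Finset.mul_sum, Finset.mul_sum]
  refine Finset.sum_congr rfl fun b _ => ?_
  split_ifs <;> ring

theorem norm_val {x : ℤ_[p]} (hx : x ≠ 0) : ‖x‖ = ((p : ℝ)⁻¹) ^ x.valuation := by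
  rw [PadicInt.norm_eq_zpow_neg_valuation hx]; simp

theorem AA_lip [IsUltrametricDist K] [Algebra ℚ_[p] K]
    (hiso : ∀ x : ℚ_[p], ‖algebraMap ℚ_[p] K x‖ = ‖x‖) (C : ℕ → Finset K)
    (hC : ∀ n : ℕ, ∀ w : K, w ∈ C n ↔ w ^ p ^ n = 1)
    (hCcard : ∀ n : ℕ, (C n).card = p ^ n) (n : ℕ) {f g : ℤ_[p] → K} {M M' : ℝ}
    (hM : 0 ≤ M) (hM' : 0 ≤ M') (hf : LipB M f) (hg : LipB M' g) (x x' : ℤ_[p]) :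
    ‖AA n f g x - AA n f g x'‖ ≤ (p * M) * (p * M') * ‖x - x'‖ := by
  have : CharZero K := charZeroK (p := p) K
  by_cases hx : x = x'
  · subst hx; simp
  have hx' := sub_ne_zero.2 hx
  set m := (x - x').valuation with hm
  have hn := norm_val hx'
  have hd : (p : ℤ_[p]) ^ m ∣ x - x' := pdvd_norm.2 hn.le
  rcases le_total n m with h | h
  · rw [AA_congr ((pow_dvd_pow _ h).trans hd), sub_self, norm_zero]
    positivity
  · obtain ⟨k, rfl⟩ := Nat.exists_eq_add_of_le h
    rw [AA_diff m k f g hd, norm_mul, norm_pow, normp hiso, hn, mul_comm]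
    refine mul_le_mul_of_nonneg_right ?_ (by positivity)
    refine IsUltrametricDist.norm_sum_le_of_forall_le_of_nonneg (by positivity) fun a _ => ?_
    refine IsUltrametricDist.norm_sum_le_of_forall_le_of_nonneg (by positivity) fun b _ => ?_
    split_ifs
    · have h1 := SC_lip hiso hM m f hf a
      have h2 := SC_lip hiso hM' m g hg b
      rw [sub_eq_add_neg]
      refine (IsUltrametricDist.norm_add_le_max _ _).trans (max_le ?_ ?_)
      · exact AA_sup hiso C hC hCcard k hM hM' h1 h2 _
      · rw [norm_neg]
        exact AA_sup hiso C hC hCcard k hM hM' h1 h2 _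
    · rw [norm_zero]; positivity
end P3


section P4
variable {p : ℕ} [Fact p.Prime] {K : Type*} [NormedField K] [Algebra ℚ_[p] K]

theorem pinv_small (p : ℕ) [Fact p.Prime] {ε : ℝ} (hε : 0 < ε) : ∃ m : ℕ, ((p : ℝ)⁻¹) ^ m ≤ ε := by
  have hp1 : (1 : ℝ) < p := by exact_mod_cast (Fact.out : p.Prime).one_lt
  obtain ⟨m, hm⟩ := exists_pow_lt_of_lt_one hε (inv_lt_one_of_one_lt₀ hp1)
  exact ⟨m, hm.le⟩

theorem UDm_of (hiso : ∀ x : ℚ_[p], ‖algebraMap ℚ_[p] K x‖ = ‖x‖) {f f' : ℤ_[p] → K}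
    (hf : IsUnifDiff f f') {ε : ℝ} (hε : 0 < ε) : ∃ m, UDm f f' ε m := by
  obtain ⟨δ, hδ, h⟩ := hf ε hε
  obtain ⟨m, hm⟩ := pinv_small p hδ
  refine ⟨m, fun x y hxy => ?_⟩
  by_cases h0 : x = y
  · subst h0; simp [emb]
  have hpos : 0 < ‖x - y‖ := norm_pos_iff.2 (sub_ne_zero.2 h0)
  have h1 := h x y hpos ((pdvd_norm.1 hxy).trans hm)
  have he : (emb (x - y) : K) ≠ 0 := by
    rw [← norm_pos_iff, norm_emb hiso]; exact hpos
  have e : f x - f y - f' y * emb (x - y) = ((f x - f y) / emb (x - y) - f' y) * emb (x - y) := by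
    field_simp
  rw [e, norm_mul, norm_emb hiso]
  gcongr

theorem UDm_mono {f f' : ℤ_[p] → K} {ε : ℝ} {m m' : ℕ} (h : UDm f f' ε m) (hm : m ≤ m') :
    UDm f f' ε m' := fun x y hxy => h x y ((pow_dvd_pow _ hm).trans hxy)

theorem emb_sub (x y : ℤ_[p]) : (emb (x - y) : K) = emb x - emb y := by simp [emb]

theorem UDm_cont [IsUltrametricDist K] (hiso : ∀ x : ℚ_[p], ‖algebraMap ℚ_[p] K x‖ = ‖x‖)
    {f f' : ℤ_[p] → K} {ε : ℝ} (hε : 0 ≤ ε) {m : ℕ} (h : UDm f f' ε m) {x y : ℤ_[p]}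
    (hxy : (p : ℤ_[p]) ^ m ∣ x - y) : ‖f' x - f' y‖ ≤ ε := by
  by_cases h0 : x = y
  · subst h0; simpa using hε
  have hpos : 0 < ‖x - y‖ := norm_pos_iff.2 (sub_ne_zero.2 h0)
  have h1 := h x y hxy
  have h2 := h y x (by rw [← neg_sub]; exact hxy.neg_right)
  rw [norm_sub_rev y x] at h2
  have e : (f' x - f' y) * emb (x - y) = (f x - f y - f' y * emb (x - y)) +
      (f y - f x - f' x * emb (y - x)) := by
    rw [emb_sub, emb_sub]; ring
  have h3 : ‖(f' x - f' y) * emb (x - y)‖ ≤ ε * ‖x - y‖ := by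
    rw [e]
    exact (IsUltrametricDist.norm_add_le_max _ _).trans (max_le h1 h2)
  rw [norm_mul, norm_emb hiso] at h3
  exact le_of_mul_le_mul_right h3 hpos

theorem bdd_of {u : ℤ_[p] → K} {B : ℝ} {m : ℕ}
    (h : ∀ x y, (p : ℤ_[p]) ^ m ∣ x - y → ‖u x - u y‖ ≤ B) : ∃ M, ∀ x, ‖u x‖ ≤ M := by
  refine ⟨B + ∑ a ∈ Finset.range (p ^ m), ‖u (a : ℤ_[p])‖, fun x => ?_⟩
  have h1 : (p : ℤ_[p]) ^ m ∣ x - (x.appr m : ℕ) :=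
    Ideal.mem_span_singleton.1 (PadicInt.appr_spec m x)
  have h2 := h _ _ h1
  have h3 : ‖u ((x.appr m : ℕ) : ℤ_[p])‖ ≤ ∑ a ∈ Finset.range (p ^ m), ‖u (a : ℤ_[p])‖ :=
    Finset.single_le_sum (f := fun a : ℕ => ‖u (a : ℤ_[p])‖) (fun _ _ => norm_nonneg _)
      (Finset.mem_range.2 (PadicInt.appr_lt x m))
  calc ‖u x‖ = ‖(u x - u ((x.appr m : ℕ) : ℤ_[p])) + u ((x.appr m : ℕ) : ℤ_[p])‖ := by simp
    _ ≤ _ := (norm_add_le _ _).trans (add_le_add h2 h3)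

theorem UD_bdd [IsUltrametricDist K] (hiso : ∀ x : ℚ_[p], ‖algebraMap ℚ_[p] K x‖ = ‖x‖)
    {f f' : ℤ_[p] → K} (hf : IsUnifDiff f f') :
    ∃ M : ℝ, 1 ≤ M ∧ LipB M f ∧ ∀ x, ‖f' x‖ ≤ M := by
  have hp0 : (0 : ℝ) < p := by exact_mod_cast (Fact.out : p.Prime).pos
  obtain ⟨m, hm⟩ := UDm_of hiso hf one_pos
  obtain ⟨M1, hM1⟩ := bdd_of (u := f') (fun x y h => UDm_cont hiso zero_le_one hm h)
  have hM1' : 0 ≤ M1 := (norm_nonneg _).trans (hM1 0)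
  have hloc : ∀ x y, (p : ℤ_[p]) ^ m ∣ x - y → ‖f x - f y‖ ≤ (1 + M1) * ‖x - y‖ := by
    intro x y h
    calc ‖f x - f y‖ = ‖(f x - f y - f' y * emb (x - y)) + f' y * emb (x - y)‖ := by simp
      _ ≤ 1 * ‖x - y‖ + M1 * ‖x - y‖ := by
        refine (norm_add_le _ _).trans (add_le_add (hm x y h) ?_)
        rw [norm_mul, norm_emb hiso]
        gcongr
        exact hM1 y
      _ = _ := by ring
  obtain ⟨M2, hM2⟩ := bdd_of (u := f) (B := 1 + M1) (m := m) (fun x y h => (hloc x y h).trans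
    (mul_le_of_le_one_right (by positivity) (PadicInt.norm_le_one _)))
  have hM2' : 0 ≤ M2 := (norm_nonneg _).trans (hM2 0)
  have hpm : 0 < ((p : ℝ)⁻¹) ^ m := by positivity
  set q := (((p : ℝ)⁻¹) ^ m)⁻¹ with hq
  have hq0 : 0 < q := by positivity
  refine ⟨1 + M1 + M2 + q * (2 * M2), ?_, ⟨fun x => (hM2 x).trans ?_, fun x y => ?_⟩,
    fun x => (hM1 x).trans ?_⟩
  · nlinarith [mul_nonneg hq0.le hM2']
  · nlinarith [mul_nonneg hq0.le hM2']
  · by_cases h : (p : ℤ_[p]) ^ m ∣ x - y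
    · refine (hloc x y h).trans ?_
      refine mul_le_mul_of_nonneg_right ?_ (norm_nonneg _)
      nlinarith [mul_nonneg hq0.le hM2']
    · rw [pdvd_norm, not_le] at h
      have h1 : ‖f x - f y‖ ≤ 2 * M2 := by
        refine (norm_sub_le _ _).trans ?_
        linarith [hM2 x, hM2 y]
      have h2 : 1 ≤ q * ‖x - y‖ := by
        rw [hq, inv_mul_eq_div, le_div_iff₀ hpm, one_mul]; exact h.le
      calc ‖f x - f y‖ ≤ 2 * M2 := h1
        _ ≤ (2 * M2) * (q * ‖x - y‖) := le_mul_of_one_le_right (by positivity) h2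
        _ ≤ _ := by nlinarith [norm_nonneg (x - y), mul_nonneg hM1' (norm_nonneg (x - y)),
                      mul_nonneg hM2' (norm_nonneg (x - y))]
  · nlinarith [mul_nonneg hq0.le hM2']

theorem emb_natCast (n : ℕ) : (emb (n : ℤ_[p]) : K) = n := by simp [emb]
theorem emb_zero' : (emb (0 : ℤ_[p]) : K) = 0 := by simp [emb]
theorem emb_mul' (x y : ℤ_[p]) : (emb (x * y) : K) = emb x * emb y := by simp [emb]
theorem emb_pow' (n : ℕ) : (emb ((p : ℤ_[p]) ^ n) : K) = (p : K) ^ n := by simp [emb]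

theorem emb_lip (hiso : ∀ x : ℚ_[p], ‖algebraMap ℚ_[p] K x‖ = ‖x‖) :
    LipB 1 (emb : ℤ_[p] → K) := by
  refine ⟨fun x => ?_, fun x y => ?_⟩
  · rw [norm_emb hiso]; exact PadicInt.norm_le_one x
  · rw [← emb_sub, norm_emb hiso, one_mul]

/-- remainder after removing the linear part -/
theorem SC_rem [IsUltrametricDist K] (hiso : ∀ x : ℚ_[p], ‖algebraMap ℚ_[p] K x‖ = ‖x‖)
    {f f' : ℤ_[p] → K} {ε : ℝ} (hε : 0 ≤ ε) {m : ℕ} (h : UDm f f' ε m) (a : ℕ) :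
    LipB ε (fun s => SC m f a s + (-f' (a : ℤ_[p])) * emb s) := by
  have : CharZero K := charZeroK (p := p) K
  have hp0 : (0 : ℝ) < p := by exact_mod_cast (Fact.out : p.Prime).pos
  have hpK : (p : K) ≠ 0 := by exact_mod_cast (Fact.out : p.Prime).ne_zero
  have key : ∀ x y : ℤ_[p], ‖(SC m f a x + (-f' (a : ℤ_[p])) * emb x) -
      (SC m f a y + (-f' (a : ℤ_[p])) * emb y)‖ ≤ ε * ‖x - y‖ := by
    intro x y
    set X := (a : ℤ_[p]) + (p : ℤ_[p]) ^ m * x with hX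
    set Y := (a : ℤ_[p]) + (p : ℤ_[p]) ^ m * y with hY
    have hXY : X - Y = (p : ℤ_[p]) ^ m * (x - y) := by rw [hX, hY]; ring
    have e : (SC m f a x + (-f' (a : ℤ_[p])) * emb x) -
      (SC m f a y + (-f' (a : ℤ_[p])) * emb y) =
      ((p : K) ^ m)⁻¹ * (f X - f Y - f' Y * emb (X - Y)) + (f' Y - f' a) * emb (x - y) := by
      rw [hXY, emb_mul', emb_pow', emb_sub]
      unfold SC
      rw [← hX, ← hY]
      field_simp
      ring
    rw [e]
    refine (IsUltrametricDist.norm_add_le_max _ _).trans (max_le ?_ ?_)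
    · rw [norm_mul, norm_inv, norm_pow, normp hiso]
      have h1 := h X Y (by rw [hXY]; exact dvd_mul_right _ _)
      have h2 : ‖X - Y‖ = ((p : ℝ)⁻¹) ^ m * ‖x - y‖ := by rw [hXY, norm_mul, norm_pp]
      rw [h2] at h1
      calc _ ≤ (((p : ℝ)⁻¹) ^ m)⁻¹ * (ε * (((p : ℝ)⁻¹) ^ m * ‖x - y‖)) := by gcongr
        _ = _ := by
          have : ((p : ℝ)⁻¹) ^ m ≠ 0 := by positivity
          field_simp
    · rw [norm_mul, norm_emb hiso]
      gcongr
      apply UDm_cont hiso hε h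
      rw [hY]; simp
  refine ⟨fun x => ?_, key⟩
  have h := key x 0
  have h0 : SC m f a 0 = 0 := by simp [SC]
  rw [h0, emb_zero', mul_zero, add_zero, sub_zero, sub_zero] at h
  exact h.trans (mul_le_of_le_one_right hε (PadicInt.norm_le_one x))

theorem wsum_small [IsUltrametricDist K] (hiso : ∀ x : ℚ_[p], ‖algebraMap ℚ_[p] K x‖ = ‖x‖)
    {u : ℤ_[p] → K} {M : ℝ} (hM0 : 0 < M) (hM : ∀ x, ‖u x‖ ≤ M) {ε : ℝ} (hε : 0 < ε) {m : ℕ}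
    (hu : ∀ x y, (p : ℤ_[p]) ^ m ∣ x - y → ‖u x - u y‖ ≤ ε) :
    ∃ n0, ∀ n ≥ n0, ∀ w : K, w ^ p ^ n = 1 →
      ‖∑ y ∈ Finset.range (p ^ n), w ^ y * u (y : ℤ_[p])‖ ≤ ε := by
  have hp0 : (0 : ℝ) < p := by exact_mod_cast (Fact.out : p.Prime).pos
  have hp1 : (1 : ℝ) ≤ p := by exact_mod_cast (Fact.out : p.Prime).one_le
  obtain ⟨j, hj⟩ := pinv_small p (div_pos hε hM0)
  refine ⟨m + j, fun n hn w hw => ?_⟩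
  obtain ⟨k, rfl⟩ := Nat.exists_eq_add_of_le (show m ≤ n by omega)
  have hk : j ≤ k := by omega
  have hw1 := norm_rootpow hw
  rw [pow_add, sum_range_split]
  refine IsUltrametricDist.norm_sum_le_of_forall_le_of_nonneg hε.le fun a _ => ?_
  have e : ∑ s ∈ Finset.range (p ^ k), w ^ (a + p ^ m * s) * u ((a + p ^ m * s : ℕ) : ℤ_[p]) =
      ∑ s ∈ Finset.range (p ^ k), w ^ (a + p ^ m * s) * (u ((a + p ^ m * s : ℕ) : ℤ_[p]) - u a) +
      w ^ a * u a * ∑ s ∈ Finset.range (p ^ k), (w ^ p ^ m) ^ s := by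
    rw [Finset.mul_sum, ← Finset.sum_add_distrib]
    refine Finset.sum_congr rfl fun s _ => ?_
    rw [pow_add, pow_mul]
    ring
  rw [e]
  refine (IsUltrametricDist.norm_add_le_max _ _).trans (max_le ?_ ?_)
  · refine IsUltrametricDist.norm_sum_le_of_forall_le_of_nonneg hε.le fun s _ => ?_
    rw [norm_mul, norm_pow, hw1, one_pow, one_mul]
    apply hu
    push_cast
    simp
  · rw [norm_mul, norm_mul, norm_pow, hw1, one_pow, one_mul]
    have : ‖∑ s ∈ Finset.range (p ^ k), (w ^ p ^ m) ^ s‖ ≤ ε / M := by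
      rcases geom_root' (P := p ^ k) (ζ := w ^ p ^ m) (by rw [← pow_mul, ← pow_add, hw]) with h | h
      · rw [h, norm_zero]; positivity
      · rw [h, Nat.cast_pow, norm_pow, normp hiso]
        exact (pow_le_pow_of_le_one (by positivity) (inv_le_one_of_one_le₀ hp1) hk).trans hj
    calc _ ≤ M * (ε / M) := by gcongr; exact hM _
      _ = ε := by field_simp

theorem FF_add (n : ℕ) (f g : ℤ_[p] → K) (w : K) :
    FF n (fun s => f s + g s) w = FF n f w + FF n g w := by
  unfold FF
  rw [← mul_add, ← Finset.sum_add_distrib]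
  simp_rw [add_mul]

theorem FF_smul (n : ℕ) (c : K) (f : ℤ_[p] → K) (w : K) :
    FF n (fun s => c * f s) w = c * FF n f w := by
  unfold FF
  rw [mul_left_comm, Finset.mul_sum (a := c)]
  simp_rw [mul_assoc]

theorem sum_id (K : Type*) [NormedField K] (P : ℕ) :
    2 * ∑ s ∈ Finset.range P, (s : K) = P * (P - 1) := by
  induction P with
  | zero => simp
  | succ P ih => rw [Finset.sum_range_succ, mul_add, ih]; push_cast; ring

theorem FF_id : FF (p := p) k (emb : ℤ_[p] → K) 1 = ((p : K) ^ k - 1) / 2 := by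
  have : CharZero K := charZeroK (p := p) K
  have hpK : (p : K) ≠ 0 := by exact_mod_cast (Fact.out : p.Prime).ne_zero
  unfold FF
  simp_rw [one_pow, mul_one, emb_natCast]
  have := sum_id K (p ^ k)
  push_cast at this
  have h2 : ∑ s ∈ Finset.range (p ^ k), (s : K) = (p : K) ^ k * ((p : K) ^ k - 1) / 2 := by
    rw [← this]; field_simp
  rw [h2]
  field_simp

theorem FF_split (n k : ℕ) (f : ℤ_[p] → K) (w : K) (hw : w ^ p ^ n = 1) :
    FF (n + k) f w = ((p : K) ^ n)⁻¹ * ∑ a ∈ Finset.range (p ^ n),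
      w ^ a * FF k (fun s => f ((a : ℤ_[p]) + (p : ℤ_[p]) ^ n * s)) 1 := by
  unfold FF
  rw [pow_add p, sum_range_split, pow_add, mul_inv, mul_assoc, Finset.mul_sum]
  congr 1
  refine Finset.sum_congr rfl fun a _ => ?_
  rw [mul_left_comm, Finset.mul_sum (a := w ^ a)]
  congr 1
  refine Finset.sum_congr rfl fun s _ => ?_
  rw [pow_add, pow_mul, hw]
  push_cast
  ring

/-- uniform convergence of Fourier coefficients -/
theorem FF_unif [IsUltrametricDist K] (hiso : ∀ x : ℚ_[p], ‖algebraMap ℚ_[p] K x‖ = ‖x‖)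
    {f f' : ℤ_[p] → K} (hf : IsUnifDiff f f') {ε : ℝ} (hε : 0 < ε) :
    ∃ n0, ∀ n ≥ n0, ∀ k, ∀ w : K, w ^ p ^ n = 1 → ‖FF (n + k) f w - FF n f w‖ ≤ ε := by
  have : CharZero K := charZeroK (p := p) K
  have hp0 : (0 : ℝ) < p := by exact_mod_cast (Fact.out : p.Prime).pos
  have hp1 : (1 : ℝ) ≤ p := by exact_mod_cast (Fact.out : p.Prime).one_le
  have hpK : (p : K) ≠ 0 := by exact_mod_cast (Fact.out : p.Prime).ne_zero
  have h2 : 0 < ‖(2 : K)‖ := norm_pos_iff.2 two_ne_zero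
  obtain ⟨M, hM1, -, hM⟩ := UD_bdd hiso hf
  have hε1 : 0 < ε * ‖(2 : K)‖ := by positivity
  obtain ⟨m1, hm1⟩ := UDm_of hiso hf hε1
  obtain ⟨n1, hn1⟩ := wsum_small hiso (by linarith) hM hε1 (fun x y => UDm_cont hiso hε1.le hm1)
  have hε2 : 0 < ε / p := by positivity
  obtain ⟨m2, hm2⟩ := UDm_of hiso hf hε2
  refine ⟨max n1 m2, fun n hn k w hw => ?_⟩
  have hw1 := norm_rootpow hw
  have hUD := UDm_mono hm2 ((le_max_right n1 m2).trans hn)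
  have hR := fun a => SC_rem hiso hε2.le hUD a
  have hpn : (p : K) ^ n ≠ 0 := pow_ne_zero _ hpK
  have e : FF (n + k) f w - FF n f w = FF (p := p) k (emb : ℤ_[p] → K) 1 *
      (∑ a ∈ Finset.range (p ^ n), w ^ a * f' (a : ℤ_[p])) +
      ∑ a ∈ Finset.range (p ^ n), w ^ a *
        FF k (fun s => SC n f a s + (-f' (a : ℤ_[p])) * emb s) 1 := by
    rw [FF_split n k f w hw]
    have : FF n f w = ((p : K) ^ n)⁻¹ * ∑ a ∈ Finset.range (p ^ n), w ^ a * f (a : ℤ_[p]) := by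
      unfold FF; simp_rw [mul_comm]
    rw [this, ← mul_sub, ← Finset.sum_sub_distrib, inv_mul_eq_iff_eq_mul₀ hpn, Finset.mul_sum,
      ← Finset.sum_add_distrib, Finset.mul_sum]
    refine Finset.sum_congr rfl fun a _ => ?_
    rw [SC_eq n f a, FF_add, FF_const, FF_smul, FF_add, FF_smul]
    ring
  rw [e]
  refine (IsUltrametricDist.norm_add_le_max _ _).trans (max_le ?_ ?_)
  · rw [norm_mul, FF_id, norm_div]
    have h3 : ‖(p : K) ^ k - 1‖ ≤ 1 := by
      rw [sub_eq_add_neg]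
      refine (IsUltrametricDist.norm_add_le_max _ _).trans (max_le ?_ (by simp))
      rw [norm_pow, normp hiso]
      exact pow_le_one₀ (by positivity) (inv_le_one_of_one_le₀ hp1)
    have h4 := hn1 n ((le_max_left n1 m2).trans hn) w hw
    calc _ ≤ 1 / ‖(2 : K)‖ * (ε * ‖(2 : K)‖) := by gcongr
      _ = ε := by field_simp
  · refine IsUltrametricDist.norm_sum_le_of_forall_le_of_nonneg hε.le fun a _ => ?_
    rw [norm_mul, norm_pow, hw1, one_pow, one_mul]
    refine (FF_bound hiso hε2.le _ (hR a) k 1 (one_pow _)).trans (le_of_eq ?_)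
    field_simp

/-- limits of Fourier coefficients -/
theorem FF_lim [IsUltrametricDist K] [CompleteSpace K]
    (hiso : ∀ x : ℚ_[p], ‖algebraMap ℚ_[p] K x‖ = ‖x‖)
    {f f' : ℤ_[p] → K} (hf : IsUnifDiff f f') {n : ℕ} {w : K} (hw : w ^ p ^ n = 1) :
    ∃ l, Tendsto (fun N => FF N f w) atTop (𝓝 l) := by
  apply cauchySeq_tendsto_of_complete
  rw [Metric.cauchySeq_iff']
  intro ε hε
  obtain ⟨n0, h⟩ := FF_unif hiso hf (half_pos hε)
  refine ⟨max n0 n, fun N hN => ?_⟩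
  obtain ⟨k, rfl⟩ := Nat.exists_eq_add_of_le hN
  rw [dist_eq_norm]
  refine (h _ (le_max_left _ _) k w ?_).trans_lt (half_lt_self hε)
  obtain ⟨j, hj⟩ := Nat.exists_eq_add_of_le (le_max_right n0 n)
  rw [hj, pow_add, pow_mul, hw, one_pow]

theorem UD_comp (hiso : ∀ x : ℚ_[p], ‖algebraMap ℚ_[p] K x‖ = ‖x‖)
    {f f' : ℤ_[p] → K} (hf : IsUnifDiff f f') (m : ℕ) (a : ℤ_[p]) :
    IsUnifDiff (fun s => f (a + (p : ℤ_[p]) ^ m * s))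
      (fun s => (p : K) ^ m * f' (a + (p : ℤ_[p]) ^ m * s)) := by
  have : CharZero K := charZeroK (p := p) K
  have hp1 : (1 : ℝ) ≤ p := by exact_mod_cast (Fact.out : p.Prime).one_le
  have hp0 : (0 : ℝ) < p := by linarith
  have hpK : (p : K) ≠ 0 := by exact_mod_cast (Fact.out : p.Prime).ne_zero
  have hle : ((p : ℝ)⁻¹) ^ m ≤ 1 := pow_le_one₀ (by positivity) (inv_le_one_of_one_le₀ hp1)
  intro ε hε
  obtain ⟨δ, hδ, h⟩ := hf ε hε
  refine ⟨δ, hδ, fun x y h1 h2 => ?_⟩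
  have e : (a + (p : ℤ_[p]) ^ m * x) - (a + (p : ℤ_[p]) ^ m * y) = (p : ℤ_[p]) ^ m * (x - y) := by
    ring
  have h3 := h (a + (p : ℤ_[p]) ^ m * x) (a + (p : ℤ_[p]) ^ m * y)
    (by rw [e, norm_mul, norm_pp]; positivity)
    (by rw [e, norm_mul, norm_pp]; exact (mul_le_of_le_one_left (norm_nonneg _) hle).trans h2)
  rw [e, emb_mul', emb_pow'] at h3
  have he : (emb (x - y) : K) ≠ 0 := by
    rw [← norm_pos_iff, norm_emb hiso]; exact h1
  have e2 : ∀ A B : K, A / emb (x - y) - (p : K) ^ m * B =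
      (p : K) ^ m * (A / ((p : K) ^ m * emb (x - y)) - B) := by
    intro A B
    field_simp
  simp only [e2, norm_mul]
  rw [norm_pow, normp hiso]
  exact (mul_le_of_le_one_left (norm_nonneg _) hle).trans h3
end P4


section P5
variable {p : ℕ} [Fact p.Prime] {K : Type*} [NormedField K] [Algebra ℚ_[p] K]

open Classical in
theorem AA_lim [IsUltrametricDist K] [CompleteSpace K]
    (hiso : ∀ x : ℚ_[p], ‖algebraMap ℚ_[p] K x‖ = ‖x‖) (C : ℕ → Finset K)
    (hC : ∀ n : ℕ, ∀ w : K, w ∈ C n ↔ w ^ p ^ n = 1)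
    (hCcard : ∀ n : ℕ, (C n).card = p ^ n)
    {f f' g g' : ℤ_[p] → K} (hf : IsUnifDiff f f') (hg : IsUnifDiff g g') (x : ℤ_[p]) :
    ∃ l, Tendsto (fun n => AA n f g x) atTop (𝓝 l) := by
  have : CharZero K := charZeroK (p := p) K
  have hp0 : (0 : ℝ) < p := by exact_mod_cast (Fact.out : p.Prime).pos
  have hpK : (p : K) ≠ 0 := by exact_mod_cast (Fact.out : p.Prime).ne_zero
  obtain ⟨M, hM1, hM, -⟩ := UD_bdd hiso hf
  obtain ⟨M', hM1', hM', -⟩ := UD_bdd hiso hg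
  apply cauchySeq_tendsto_of_complete
  rw [Metric.cauchySeq_iff']
  intro ε hε
  have hB : 0 < (p * M) * (p * M') := by positivity
  obtain ⟨m, hm⟩ := pinv_small p (ε := ε / 4 / ((p * M) * (p * M'))) (by positivity)
  rw [le_div_iff₀ hB] at hm
  set T : ℕ → K := fun k => ((p : K) ^ m)⁻¹ * ∑ a ∈ Finset.range (p ^ m), ∑ b ∈ Finset.range (p ^ m),
      if (p : ℤ_[p]) ^ m ∣ x - a - b then
        (f a * FF k (fun s => g ((b : ℤ_[p]) + (p : ℤ_[p]) ^ m * s)) 1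
        + g b * FF k (fun s => f ((a : ℤ_[p]) + (p : ℤ_[p]) ^ m * s)) 1 - f a * g b) else 0 with hT
  have hdec : ∀ k, ‖AA (m + k) f g x - T k‖ ≤ ε / 4 := by
    intro k
    have : AA (m + k) f g x - T k = ∑ a ∈ Finset.range (p ^ m), ∑ b ∈ Finset.range (p ^ m),
      if (p : ℤ_[p]) ^ m ∣ x - a - b then
        ((p : K) ^ m * AA k (SC m f a) (SC m g b) (qt m (x - (a : ℤ_[p]) - (b : ℤ_[p])))) else 0 := by
      rw [AA_star, hT]
      simp only
      rw [← mul_sub, ← Finset.sum_sub_distrib, Finset.mul_sum]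
      refine Finset.sum_congr rfl fun a _ => ?_
      rw [← Finset.sum_sub_distrib, Finset.mul_sum]
      refine Finset.sum_congr rfl fun b _ => ?_
      split_ifs
      · field_simp; ring
      · simp
    rw [this]
    refine IsUltrametricDist.norm_sum_le_of_forall_le_of_nonneg (by positivity) fun a _ => ?_
    refine IsUltrametricDist.norm_sum_le_of_forall_le_of_nonneg (by positivity) fun b _ => ?_
    split_ifs
    · rw [norm_mul, norm_pow, normp hiso]
      refine (mul_le_mul_of_nonneg_left (AA_sup hiso C hC hCcard k (by linarith) (by linarith)
        (SC_lip hiso (by linarith) m f hM a) (SC_lip hiso (by linarith) m g hM' b) _)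
        (by positivity)).trans hm
    · rw [norm_zero]; positivity
  have hTl : ∃ l, Tendsto T atTop (𝓝 l) := by
    have h1 : ∀ a : ℕ, ∃ l, Tendsto (fun k => FF k (fun s => f ((a : ℤ_[p]) + (p : ℤ_[p]) ^ m * s)) 1)
        atTop (𝓝 l) := fun a => FF_lim hiso (UD_comp hiso hf m a) (n := 0) (by simp)
    have h2 : ∀ a : ℕ, ∃ l, Tendsto (fun k => FF k (fun s => g ((a : ℤ_[p]) + (p : ℤ_[p]) ^ m * s)) 1)
        atTop (𝓝 l) := fun a => FF_lim hiso (UD_comp hiso hg m a) (n := 0) (by simp)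
    choose lf hlf using h1
    choose lg hlg using h2
    refine ⟨((p : K) ^ m)⁻¹ * ∑ a ∈ Finset.range (p ^ m), ∑ b ∈ Finset.range (p ^ m),
      if (p : ℤ_[p]) ^ m ∣ x - a - b then
        (f a * lg b + g b * lf a - f a * g b) else 0, ?_⟩
    refine Tendsto.const_mul _ (tendsto_finsetSum _ fun a _ => tendsto_finsetSum _ fun b _ => ?_)
    split_ifs
    · exact (((hlg b).const_mul _).add ((hlf a).const_mul _)).sub_const _
    · exact tendsto_const_nhds
  obtain ⟨l, hl⟩ := hTl
  obtain ⟨k0, hk0⟩ := Metric.cauchySeq_iff'.1 hl.cauchySeq (ε / 4) (by positivity)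
  refine ⟨m + k0, fun n hn => ?_⟩
  obtain ⟨k, rfl⟩ := Nat.exists_eq_add_of_le ((Nat.le_add_right m k0).trans hn)
  have h3 := hk0 k (by omega)
  rw [dist_eq_norm] at h3 ⊢
  have h4 := hdec k
  have h5 := hdec k0
  calc _ = ‖(AA (m + k) f g x - T k) + (T k - T k0) - (AA (m + k0) f g x - T k0)‖ := by
        congr 1; ring
    _ ≤ ‖(AA (m + k) f g x - T k)‖ + ‖(T k - T k0)‖ + ‖(AA (m + k0) f g x - T k0)‖ :=
        (norm_sub_le _ _).trans (add_le_add_left (norm_add_le _ _) _)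
    _ < ε := by linarith

theorem sum_sq (K : Type*) [NormedField K] (P : ℕ) :
    6 * ∑ s ∈ Finset.range P, (s : K) * s = P * (P - 1) * (2 * P - 1) := by
  induction P with
  | zero => simp
  | succ P ih => rw [Finset.sum_range_succ, mul_add, ih]; push_cast; ring

theorem AA_emb (k : ℕ) (c : ℤ_[p]) : AA k (emb : ℤ_[p] → K) emb c =
    (c.appr k : K) * ((p : K) ^ k - 1) / 2 - ((p : K) ^ k - 1) * (2 * (p : K) ^ k - 1) / 6
      + ((p : K) ^ k * ((p : K) ^ k - 1) - (c.appr k : K) * (c.appr k + 1)) / 2 := by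
  classical
  have : CharZero K := charZeroK (p := p) K
  have hpK : (p : K) ≠ 0 := by exact_mod_cast (Fact.out : p.Prime).ne_zero
  set c0 := c.appr k with hc0
  have hlt : c0 < p ^ k := PadicInt.appr_lt c k
  have hdv : (p : ℤ_[p]) ^ k ∣ c - (c0 : ℕ) :=
    Ideal.mem_span_singleton.1 (PadicInt.appr_spec k c)
  have hin : ∀ s ∈ Finset.range (p ^ k), (∑ z ∈ Finset.range (p ^ k),
      if (p : ℤ_[p]) ^ k ∣ c - s - z then (emb (s : ℤ_[p]) : K) * emb (z : ℤ_[p]) else 0) =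
      (c0 * s - s * s) + (p : K) ^ k * (s - if s < c0 + 1 then (s : K) else 0) := by
    intro s hs
    rw [Finset.mem_range] at hs
    obtain ⟨z0, h0, h1⟩ := exists_uniq_z k (c - (s : ℤ_[p]))
    have hz : (z0 : K) = (c0 - s) + if s < c0 + 1 then 0 else (p : K) ^ k := by
      split_ifs with h
      · have : c0 - s = z0 := by
          rw [← h1 _ (Finset.mem_range.2 (by omega)), Nat.cast_sub (by omega)]
          convert hdv using 1; ring
        rw [← this, Nat.cast_sub (by omega)]; ring
      · have : c0 + p ^ k - s = z0 := by
          rw [← h1 _ (Finset.mem_range.2 (by omega)), Nat.cast_sub (by omega)]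
          have := dvd_sub hdv (dvd_refl ((p : ℤ_[p]) ^ k))
          convert this using 1; push_cast; ring
        rw [← this, Nat.cast_sub (by omega)]; push_cast; ring
    rw [Finset.sum_eq_single z0]
    · rw [if_pos ((h1 z0 h0).2 rfl), emb_natCast, emb_natCast, hz]
      split_ifs <;> ring
    · intro z hz hne
      rw [if_neg (fun h => hne ((h1 z hz).1 h))]
    · intro h; exact absurd h0 h
  have hS1 := sum_id K (p ^ k)
  have hS2 := sum_sq K (p ^ k)
  have hS3 := sum_id K (c0 + 1)
  push_cast at hS1 hS2 hS3
  have hS4 : ∑ s ∈ Finset.range (p ^ k), (if s < c0 + 1 then (s : K) else 0) =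
      ∑ s ∈ Finset.range (c0 + 1), (s : K) := by
    rw [← Finset.sum_filter]
    congr 1
    ext s; simp; omega
  unfold AA
  rw [Finset.sum_congr rfl hin, Finset.sum_add_distrib, ← Finset.mul_sum, Finset.sum_sub_distrib,
    Finset.sum_sub_distrib, ← Finset.mul_sum, hS4]
  have e1 : ∑ s ∈ Finset.range (p ^ k), (s : K) = (p : K) ^ k * ((p : K) ^ k - 1) / 2 := by
    rw [← hS1]; field_simp
  have e2 : ∑ s ∈ Finset.range (p ^ k), (s : K) * s =
      (p : K) ^ k * ((p : K) ^ k - 1) * (2 * (p : K) ^ k - 1) / 6 := by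
    rw [← hS2]; field_simp
  have e3 : ∑ s ∈ Finset.range (c0 + 1), (s : K) = ((c0 : K) + 1) * c0 / 2 := by
    rw [eq_div_iff two_ne_zero, mul_comm, hS3]; ring
  rw [e1, e2, e3]
  field_simp

theorem AA_emb_lim (hiso : ∀ x : ℚ_[p], ‖algebraMap ℚ_[p] K x‖ = ‖x‖) (c : ℤ_[p]) :
    Tendsto (fun k => AA k (emb : ℤ_[p] → K) emb c) atTop
      (𝓝 (-(emb c * emb c + 2 * emb c) / 2 - 1 / 6)) := by
  have hp1 : (1 : ℝ) < p := by exact_mod_cast (Fact.out : p.Prime).one_lt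
  have hr : ((p : ℝ)⁻¹) < 1 := inv_lt_one_of_one_lt₀ hp1
  have hP : Tendsto (fun k => (p : K) ^ k) atTop (𝓝 0) :=
    tendsto_pow_atTop_nhds_zero_of_norm_lt_one (by rw [normp hiso]; exact hr)
  have hc : Tendsto (fun k => (c.appr k : K)) atTop (𝓝 (emb c)) := by
    rw [tendsto_iff_norm_sub_tendsto_zero]
    refine squeeze_zero (fun _ => norm_nonneg _) (fun k => ?_)
      (tendsto_pow_atTop_nhds_zero_of_lt_one (by positivity) hr)
    rw [← emb_natCast (p := p), ← emb_sub, norm_emb hiso, norm_sub_rev, ← pdvd_norm]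
    exact Ideal.mem_span_singleton.1 (PadicInt.appr_spec k c)
  simp_rw [AA_emb]
  have := ((((hc.mul (hP.sub_const 1)).div_const 2).sub
    (((hP.sub_const 1).mul ((hP.const_mul 2).sub_const 1)).div_const 6)).add
    (((hP.mul (hP.sub_const 1)).sub (hc.mul (hc.add_const 1))).div_const 2))
  convert this using 2
  have : CharZero K := charZeroK (p := p) K
  field_simp
  ring

end P5


section P6
variable {p : ℕ} [Fact p.Prime] {K : Type*} [NormedField K] [Algebra ℚ_[p] K]

theorem UD_crit [CompleteSpace K]
    {h : ℤ_[p] → K} (H : ∀ ε : ℝ, 0 < ε → ∃ m : ℕ, ∀ x x' x'' : ℤ_[p],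
      (p : ℤ_[p]) ^ m ∣ x' - x → (p : ℤ_[p]) ^ m ∣ x'' - x → x' ≠ x → x'' ≠ x →
      ‖(h x' - h x) / emb (x' - x) - (h x'' - h x) / emb (x'' - x)‖ ≤ ε) :
    ∃ h', IsUnifDiff h h' := by
  have hpZ : (p : ℤ_[p]) ≠ 0 := by exact_mod_cast (Fact.out : p.Prime).ne_zero
  have hp0 : (0 : ℝ) < p := by exact_mod_cast (Fact.out : p.Prime).pos
  have hlim : ∀ y : ℤ_[p], ∃ l : K, Tendsto (fun n => (h (y + (p : ℤ_[p]) ^ n) - h y) /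
      emb (y + (p : ℤ_[p]) ^ n - y)) atTop (𝓝 l) := by
    intro y
    apply cauchySeq_tendsto_of_complete
    rw [Metric.cauchySeq_iff']
    intro ε hε
    obtain ⟨m, hm⟩ := H (ε / 2) (by positivity)
    refine ⟨m, fun n hn => ?_⟩
    rw [dist_eq_norm]
    refine (hm y _ _ ?_ ?_ ?_ ?_).trans_lt (by linarith)
    · simpa using pow_dvd_pow _ hn
    · simp
    · simp [hpZ]
    · simp [hpZ]
  choose h' hh' using hlim
  refine ⟨h', fun ε hε => ?_⟩
  obtain ⟨m, hm⟩ := H ε hε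
  refine ⟨((p : ℝ)⁻¹) ^ m, by positivity, fun x y h0 h1 => ?_⟩
  rw [← pdvd_norm] at h1
  refine le_of_tendsto ((tendsto_const_nhds.sub (hh' y)).norm) ?_
  filter_upwards [eventually_ge_atTop m] with n hn
  refine hm y _ _ h1 ?_ ?_ ?_
  · simpa using pow_dvd_pow _ hn
  · rintro rfl; simp at h0
  · simp [hpZ]

theorem AA_lin [IsUltrametricDist K]
    (hiso : ∀ x : ℚ_[p], ‖algebraMap ℚ_[p] K x‖ = ‖x‖) (C : ℕ → Finset K)
    (hC : ∀ n : ℕ, ∀ w : K, w ∈ C n ↔ w ^ p ^ n = 1)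
    (hCcard : ∀ n : ℕ, (C n).card = p ^ n)
    {f f' g g' : ℤ_[p] → K} {M ε : ℝ} {m : ℕ} (hM : 0 ≤ M) (hε : 0 ≤ ε)
    (hf'M : ∀ x, ‖f' x‖ ≤ M) (hg : LipB M g)
    (uf : UDm f f' ε m) (ug : UDm g g' ε m) (k a b : ℕ) (c c' : ℤ_[p]) :
    ‖(AA k (SC m f a) (SC m g b) c' - AA k (SC m f a) (SC m g b) c) -
      f' a * g' b * (AA k (emb : ℤ_[p] → K) emb c' - AA k (emb : ℤ_[p] → K) emb c)‖ ≤
      (2 * p ^ 2 * M * ε) * ‖c' - c‖ := by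
  have hR := SC_rem hiso hε uf a
  have hS := SC_rem hiso hε ug b
  set R := (fun s => SC m f a s + (-f' (a : ℤ_[p])) * emb s) with hRd
  set S := (fun s => SC m g b s + (-g' (b : ℤ_[p])) * emb s) with hSd
  have e1 : SC m f a = fun s => R s + f' a * emb s := by funext s; simp [hRd]
  have e2 : SC m g b = fun s => S s + g' b * emb s := by funext s; simp [hSd]
  have hG : LipB M (SC m g b) := SC_lip hiso hM m g hg b
  have key : ∀ c, AA k (SC m f a) (SC m g b) c = AA k R (SC m g b) c + f' a * (AA k emb S c +
      g' b * AA k (emb : ℤ_[p] → K) emb c) := by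
    intro c
    conv_lhs => rw [e1, AA_add_left, AA_smul_left]
    conv_lhs => arg 2; rw [e2, AA_add_right, AA_smul_right]
  rw [key c, key c']
  have h1 := AA_lip hiso C hC hCcard k hε hM hR hG c' c
  have h2 := AA_lip hiso C hC hCcard k zero_le_one hε (emb_lip hiso) hS c' c
  calc _ = ‖(AA k R (SC m g b) c' - AA k R (SC m g b) c) + f' a * (AA k emb S c' - AA k emb S c)‖ := by
        congr 1; ring
    _ ≤ (p * ε) * (p * M) * ‖c' - c‖ + M * ((p * 1) * (p * ε) * ‖c' - c‖) := by
        refine (norm_add_le _ _).trans (add_le_add h1 ?_)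
        rw [norm_mul]
        exact mul_le_mul (hf'M _) h2 (norm_nonneg _) hM
    _ = _ := by ring

open Classical in
/-- approximate difference quotient -/
noncomputable def GG (f' g' : ℤ_[p] → K) (m : ℕ) (x x' : ℤ_[p]) : K :=
  ∑ a ∈ Finset.range (p ^ m), ∑ b ∈ Finset.range (p ^ m),
      if (p : ℤ_[p]) ^ m ∣ x - a - b then
        f' a * g' b * (-(emb (qt m (x - (a : ℤ_[p]) - (b : ℤ_[p]))) +
          emb (qt m (x' - (a : ℤ_[p]) - (b : ℤ_[p]))) + 2) / 2) else 0

open Classical in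
theorem h_approx [IsUltrametricDist K]
    (hiso : ∀ x : ℚ_[p], ‖algebraMap ℚ_[p] K x‖ = ‖x‖) (C : ℕ → Finset K)
    (hC : ∀ n : ℕ, ∀ w : K, w ∈ C n ↔ w ^ p ^ n = 1)
    (hCcard : ∀ n : ℕ, (C n).card = p ^ n)
    {f f' g g' : ℤ_[p] → K} {M ε : ℝ} {m : ℕ} (hM : 0 ≤ M) (hε : 0 ≤ ε)
    (hf'M : ∀ x, ‖f' x‖ ≤ M) (hg : LipB M g)
    (uf : UDm f f' ε m) (ug : UDm g g' ε m) {h : ℤ_[p] → K}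
    (hh : ∀ x, Tendsto (fun n => AA n f g x) atTop (𝓝 (h x))) {x x' : ℤ_[p]}
    (hx : (p : ℤ_[p]) ^ m ∣ x' - x) :
    ‖h x' - h x - emb (x' - x) * GG f' g' m x x'‖ ≤ (2 * p ^ 2 * M * ε) * ‖x' - x‖ := by
  have : CharZero K := charZeroK (p := p) K
  have hp0 : (0 : ℝ) < p := by exact_mod_cast (Fact.out : p.Prime).pos
  set c : ℕ → ℕ → ℤ_[p] := fun a b => qt m (x - (a : ℤ_[p]) - (b : ℤ_[p])) with hc
  set c' : ℕ → ℕ → ℤ_[p] := fun a b => qt m (x' - (a : ℤ_[p]) - (b : ℤ_[p])) with hc'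
  have hcc : ∀ a b : ℕ, (p : ℤ_[p]) ^ m ∣ x - a - b → (p : ℤ_[p]) ^ m * (c' a b - c a b) = x' - x := by
    intro a b hd
    have h1 := qt_spec hd
    have h2 := qt_spec ((cond_iff hx a b).2 hd)
    simp only [hc, hc']
    rw [mul_sub, h1, h2]; ring
  set E : ℕ → K := fun k => (p : K) ^ m *
      ∑ a ∈ Finset.range (p ^ m), ∑ b ∈ Finset.range (p ^ m),
      if (p : ℤ_[p]) ^ m ∣ x - a - b then
        f' a * g' b * (AA k (emb : ℤ_[p] → K) emb (c' a b) - AA k (emb : ℤ_[p] → K) emb (c a b)) else 0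
    with hE
  have hElim : Tendsto E atTop (𝓝 (emb (x' - x) * GG f' g' m x x')) := by
    have : emb (x' - x) * GG f' g' m x x' = (p : K) ^ m *
      ∑ a ∈ Finset.range (p ^ m), ∑ b ∈ Finset.range (p ^ m),
      if (p : ℤ_[p]) ^ m ∣ x - a - b then
        f' a * g' b * ((-(emb (c' a b) * emb (c' a b) + 2 * emb (c' a b)) / 2 - 1 / 6) -
          (-(emb (c a b) * emb (c a b) + 2 * emb (c a b)) / 2 - 1 / 6)) else 0 := by
      unfold GG
      rw [Finset.mul_sum, Finset.mul_sum]
      refine Finset.sum_congr rfl fun a _ => ?_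
      rw [Finset.mul_sum, Finset.mul_sum]
      refine Finset.sum_congr rfl fun b _ => ?_
      split_ifs with hd
      · rw [← hcc a b hd, emb_mul', emb_pow', emb_sub]
        ring
      · simp
    rw [this]
    refine Tendsto.const_mul _ (tendsto_finsetSum _ fun a _ => tendsto_finsetSum _ fun b _ => ?_)
    split_ifs
    · exact ((AA_emb_lim hiso _).sub (AA_emb_lim hiso _)).const_mul _
    · exact tendsto_const_nhds
  have hA : ∀ x, Tendsto (fun k => AA (m + k) f g x) atTop (𝓝 (h x)) := fun x => by
    have := (tendsto_add_atTop_iff_nat m).2 (hh x)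
    simpa [add_comm] using this
  refine le_of_tendsto (((hA x').sub (hA x)).sub hElim).norm (Eventually.of_forall fun k => ?_)
  rw [AA_diff m k f g hx, hE]
  simp only
  rw [← mul_sub, ← Finset.sum_sub_distrib, Finset.mul_sum]
  refine IsUltrametricDist.norm_sum_le_of_forall_le_of_nonneg (by positivity) fun a _ => ?_
  rw [← Finset.sum_sub_distrib, Finset.mul_sum]
  refine IsUltrametricDist.norm_sum_le_of_forall_le_of_nonneg (by positivity) fun b _ => ?_
  split_ifs with hd
  · rw [norm_mul, norm_pow, normp hiso]
    calc _ ≤ ((p : ℝ)⁻¹) ^ m * ((2 * p ^ 2 * M * ε) * ‖c' a b - c a b‖) :=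
          mul_le_mul_of_nonneg_left (AA_lin hiso C hC hCcard hM hε hf'M hg uf ug k a b _ _)
            (by positivity)
      _ = _ := by
          rw [← hcc a b hd, norm_mul, norm_pp]; ring
  · simp; positivity

theorem GG_close [IsUltrametricDist K]
    (hiso : ∀ x : ℚ_[p], ‖algebraMap ℚ_[p] K x‖ = ‖x‖)
    {f' g' : ℤ_[p] → K} {M : ℝ} (m : ℕ) (hM : 0 ≤ M)
    (hf'M : ∀ x, ‖f' x‖ ≤ M) (hg'M : ∀ x, ‖g' x‖ ≤ M) {x x' x'' : ℤ_[p]}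
    (hx : (p : ℤ_[p]) ^ m ∣ x' - x) (hx2 : (p : ℤ_[p]) ^ m ∣ x'' - x) :
    ‖GG f' g' m x x' - GG f' g' m x x''‖ ≤ M * M * ‖(2 : K)⁻¹‖ * p ^ m * ‖x' - x''‖ := by
  have hp0 : (0 : ℝ) < p := by exact_mod_cast (Fact.out : p.Prime).pos
  unfold GG
  rw [← Finset.sum_sub_distrib]
  refine IsUltrametricDist.norm_sum_le_of_forall_le_of_nonneg (by positivity) fun a _ => ?_
  rw [← Finset.sum_sub_distrib]
  refine IsUltrametricDist.norm_sum_le_of_forall_le_of_nonneg (by positivity) fun b _ => ?_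
  split_ifs with hd
  · have h1 := qt_spec ((cond_iff hx a b).2 hd)
    have h2 := qt_spec ((cond_iff hx2 a b).2 hd)
    set c' := qt m (x' - (a : ℤ_[p]) - (b : ℤ_[p]))
    set c'' := qt m (x'' - (a : ℤ_[p]) - (b : ℤ_[p]))
    have h3 : (p : ℤ_[p]) ^ m * (c' - c'') = x' - x'' := by rw [mul_sub, h1, h2]; ring
    have h4 : ‖c' - c''‖ = p ^ m * ‖x' - x''‖ := by
      rw [← h3, norm_mul, norm_pp, inv_pow, ← mul_assoc, mul_inv_cancel₀ (by positivity), one_mul]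
    calc _ = ‖f' a * g' b * ((2 : K)⁻¹ * -(emb (c' - c'')))‖ := by
          rw [emb_sub]; congr 1; ring
      _ = ‖f' a‖ * ‖g' b‖ * (‖(2 : K)⁻¹‖ * ‖c' - c''‖) := by
          rw [norm_mul, norm_mul, norm_mul, norm_neg, norm_emb hiso]
      _ ≤ M * M * (‖(2 : K)⁻¹‖ * ‖c' - c''‖) := by
          gcongr
          · exact hf'M _
          · exact hg'M _
      _ = _ := by rw [h4]; ring
  · simp; positivity

theorem LipB_mono {M M' : ℝ} (h : M ≤ M') {f : ℤ_[p] → K} (hf : LipB M f) : LipB M' f :=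
  ⟨fun x => (hf.1 x).trans h, fun x y => (hf.2 x y).trans
    (mul_le_mul_of_nonneg_right h (norm_nonneg _))⟩

theorem h_UD [IsUltrametricDist K] [CompleteSpace K]
    (hiso : ∀ x : ℚ_[p], ‖algebraMap ℚ_[p] K x‖ = ‖x‖) (C : ℕ → Finset K)
    (hC : ∀ n : ℕ, ∀ w : K, w ∈ C n ↔ w ^ p ^ n = 1)
    (hCcard : ∀ n : ℕ, (C n).card = p ^ n)
    {f f' g g' : ℤ_[p] → K} (hf : IsUnifDiff f f') (hg : IsUnifDiff g g') {h : ℤ_[p] → K}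
    (hh : ∀ x, Tendsto (fun n => AA n f g x) atTop (𝓝 (h x))) :
    ∃ h', IsUnifDiff h h' := by
  have : CharZero K := charZeroK (p := p) K
  have hp0 : (0 : ℝ) < p := by exact_mod_cast (Fact.out : p.Prime).pos
  obtain ⟨M1, hM1, hfM, hf'M⟩ := UD_bdd hiso hf
  obtain ⟨M2, hM2, hgM, hg'M⟩ := UD_bdd hiso hg
  set M := max M1 M2 with hMd
  have hM : 1 ≤ M := hM1.trans (le_max_left _ _)
  have hf'M' : ∀ x, ‖f' x‖ ≤ M := fun x => (hf'M x).trans (le_max_left _ _)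
  have hg'M' : ∀ x, ‖g' x‖ ≤ M := fun x => (hg'M x).trans (le_max_right _ _)
  have hgM' : LipB M g := LipB_mono (le_max_right _ _) hgM
  refine UD_crit fun ε hε => ?_
  set η := ε / 3 / (2 * p ^ 2 * M) with hη
  have hη0 : 0 < η := by positivity
  have hηε : 2 * p ^ 2 * M * η = ε / 3 := by rw [hη]; field_simp
  obtain ⟨m1, u1⟩ := UDm_of hiso hf hη0
  obtain ⟨m2, u2⟩ := UDm_of hiso hg hη0
  obtain ⟨m, v1, v2⟩ : ∃ m, UDm f f' η m ∧ UDm g g' η m := ⟨max m1 m2,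
    fun x y hd => u1 x y ((pow_dvd_pow _ (le_max_left _ _)).trans hd),
    fun x y hd => u2 x y ((pow_dvd_pow _ (le_max_right _ _)).trans hd)⟩
  have h2 : 0 < ‖(2 : K)⁻¹‖ := by rw [norm_pos_iff]; exact inv_ne_zero two_ne_zero
  have hB : 0 < M * M * ‖(2 : K)⁻¹‖ * p ^ m := by positivity
  obtain ⟨m', hm'⟩ := pinv_small p (ε := ε / 3 / (M * M * ‖(2 : K)⁻¹‖ * p ^ m)) (by positivity)
  rw [le_div_iff₀ hB] at hm'
  have quo : ∀ x x' : ℤ_[p], (p : ℤ_[p]) ^ m ∣ x' - x → x' ≠ x →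
      ‖(h x' - h x) / emb (x' - x) - GG f' g' m x x'‖ ≤ ε / 3 := by
    intro x x' hd hne
    have hn : 0 < ‖x' - x‖ := norm_pos_iff.2 (sub_ne_zero.2 hne)
    have hn' : (emb (x' - x) : K) ≠ 0 := by
      rw [← norm_pos_iff, norm_emb hiso]; exact hn
    have := h_approx hiso C hC hCcard (by linarith) hη0.le hf'M' hgM' v1 v2 hh hd
    rw [hηε] at this
    have e : (h x' - h x) / emb (x' - x) - GG f' g' m x x' =
        (h x' - h x - emb (x' - x) * GG f' g' m x x') / emb (x' - x) := by field_simp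
    rw [e, norm_div, norm_emb hiso, div_le_iff₀ hn]
    exact this
  refine ⟨max m m', fun x x' x'' hd hd2 hne hne2 => ?_⟩
  have a1 : (p : ℤ_[p]) ^ m ∣ x' - x := (pow_dvd_pow _ (le_max_left _ _)).trans hd
  have a2 : (p : ℤ_[p]) ^ m ∣ x'' - x := (pow_dvd_pow _ (le_max_left _ _)).trans hd2
  have a3 : (p : ℤ_[p]) ^ m' ∣ x' - x'' := by
    have := dvd_sub ((pow_dvd_pow (p : ℤ_[p]) (le_max_right m m')).trans hd)
      ((pow_dvd_pow (p : ℤ_[p]) (le_max_right m m')).trans hd2)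
    simpa using this
  rw [pdvd_norm] at a3
  have b1 := quo x x' a1 hne
  have b2 := quo x x'' a2 hne2
  have b3 : ‖GG f' g' m x x' - GG f' g' m x x''‖ ≤ ε / 3 := by
    refine (GG_close hiso m (by linarith) hf'M' hg'M' a1 a2).trans (le_trans ?_ hm')
    rw [mul_comm]
    exact mul_le_mul_of_nonneg_right a3 hB.le
  calc _ = ‖((h x' - h x) / emb (x' - x) - GG f' g' m x x') + (GG f' g' m x x' - GG f' g' m x x'')
        - ((h x'' - h x) / emb (x'' - x) - GG f' g' m x x'')‖ := by congr 1; ring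
    _ ≤ _ := (norm_sub_le _ _).trans (add_le_add_left (norm_add_le _ _) _)
    _ ≤ ε := by linarith

end P6


section P7
variable {p : ℕ} [Fact p.Prime] {K : Type*} [NormedField K] [Algebra ℚ_[p] K]

theorem phi_nat {w : K} {n : ℕ} (hw : w ^ p ^ n = 1) (y : ℕ) : phi w n (y : ℤ_[p]) = w ^ y := by
  unfold phi
  have h1 : (p : ℤ_[p]) ^ n ∣ (y : ℤ_[p]) - ((y : ℤ_[p]).appr n : ℕ) :=
    Ideal.mem_span_singleton.1 (PadicInt.appr_spec n _)
  obtain ⟨z0, h0, hz⟩ := exists_uniq_z n (y : ℤ_[p])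
  have e1 := (hz _ (Finset.mem_range.2 (PadicInt.appr_lt (y : ℤ_[p]) n))).1 h1
  have hpos : 0 < p ^ n := pow_pos (Fact.out : p.Prime).pos n
  have e2 : y % p ^ n = z0 := by
    refine (hz _ (Finset.mem_range.2 (Nat.mod_lt _ hpos))).1 ?_
    have := Nat.mod_add_div y (p ^ n)
    refine ⟨((y / p ^ n : ℕ) : ℤ_[p]), ?_⟩
    conv_lhs => arg 1; rw [← this]
    push_cast
    ring
  rw [e1, ← e2]
  conv_rhs => rw [← Nat.mod_add_div y (p ^ n), pow_add, pow_mul, hw, one_pow, mul_one]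

theorem fc_eq [CompleteSpace K] [IsUltrametricDist K]
    (hiso : ∀ x : ℚ_[p], ‖algebraMap ℚ_[p] K x‖ = ‖x‖)
    (L : K) (hL0 : 0 < ‖L‖) (hL1 : ‖L‖ < (p : ℝ) ^ (-1 / ((p : ℝ) - 1)))
    {f : ℤ_[p] → K} {n : ℕ} {w v l : K} (hw : w ^ p ^ n = 1)
    (hv : HasIq p L (fun x => phi w n x * qpow L (-x) * f x) v)
    (hl : Tendsto (fun N => FF N f w) atTop (𝓝 l)) :
    v = ((-L)⁻¹ * (1 - pExp L)) * l := by
  have : CharZero K := charZeroK (p := p) K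
  have hpK : (p : K) ≠ 0 := by exact_mod_cast (Fact.out : p.Prime).ne_zero
  refine tendsto_nhds_unique hv ?_
  have h := (qb_lim hiso L hL0 hL1).mul hl
  refine h.congr fun N => ?_
  unfold FF
  rw [mul_assoc, mul_inv_cancel_left₀ (pow_ne_zero _ hpK)]
  congr 1
  refine Finset.sum_congr rfl fun y _ => ?_
  simp only
  rw [phi_nat hw]
  linear_combination (-(w ^ y * f y)) * qpow_neg_mul hiso L hL1 (y : ℤ_[p])

theorem UD_smul {h h' : ℤ_[p] → K} (H : IsUnifDiff h h') (c : K) :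
    IsUnifDiff (fun x => c * h x) (fun x => c * h' x) := by
  intro ε hε
  obtain ⟨δ, hδ, h1⟩ := H (ε / (1 + ‖c‖)) (by positivity)
  refine ⟨δ, hδ, fun x y h0 h2 => ?_⟩
  have := h1 x y h0 h2
  have e : (c * h x - c * h y) / emb (x - y) - c * h' y =
    c * ((h x - h y) / emb (x - y) - h' y) := by ring
  rw [e, norm_mul]
  rw [le_div_iff₀ (by positivity)] at this
  nlinarith [norm_nonneg ((h x - h y) / emb (x - y) - h' y), norm_nonneg c]

theorem sum_close [IsUltrametricDist K] [CompleteSpace K]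
    (hiso : ∀ x : ℚ_[p], ‖algebraMap ℚ_[p] K x‖ = ‖x‖) (C : ℕ → Finset K)
    (hC : ∀ n : ℕ, ∀ w : K, w ∈ C n ↔ w ^ p ^ n = 1)
    (hCcard : ∀ n : ℕ, (C n).card = p ^ n)
    {f f' g g' : ℤ_[p] → K} (hf : IsUnifDiff f f') (hg : IsUnifDiff g g')
    (fl gl : K → K) 
    (hfl : ∀ (n : ℕ) (w : K), w ^ p ^ n = 1 → Tendsto (fun N => FF N f w) atTop (𝓝 (fl w)))
    (hgl : ∀ (n : ℕ) (w : K), w ^ p ^ n = 1 → Tendsto (fun N => FF N g w) atTop (𝓝 (gl w)))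
    (x : ℤ_[p]) :
    Tendsto (fun n => ∑ w ∈ C n, fl w * gl w * phi w⁻¹ n x - AA n f g x) atTop (𝓝 0) := by
  have : CharZero K := charZeroK (p := p) K
  have hp0 : (0 : ℝ) < p := by exact_mod_cast (Fact.out : p.Prime).pos
  obtain ⟨M, hM1, hM, -⟩ := UD_bdd hiso hf
  obtain ⟨M', hM1', hM', -⟩ := UD_bdd hiso hg
  have unif : ∀ {u u' : ℤ_[p] → K} (_ : IsUnifDiff u u') (ul : K → K)
      (_ : ∀ (n : ℕ) (w : K), w ^ p ^ n = 1 → Tendsto (fun N => FF N u w) atTop (𝓝 (ul w)))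
      {ε : ℝ} (_ : 0 < ε), ∃ n0, ∀ n ≥ n0, ∀ w : K, w ^ p ^ n = 1 → ‖ul w - FF n u w‖ ≤ ε := by
    intro u u' hu ul hul ε hε
    obtain ⟨n0, hn0⟩ := FF_unif hiso hu hε
    refine ⟨n0, fun n hn w hw => ?_⟩
    refine le_of_tendsto ((hul n w hw).sub_const _).norm ?_
    filter_upwards [eventually_ge_atTop n] with N hN
    obtain ⟨k, rfl⟩ := Nat.exists_eq_add_of_le hN
    exact hn0 n hn k w hw
  have hgb : ∀ (n : ℕ) (w : K), w ^ p ^ n = 1 → ‖gl w‖ ≤ p * M' := by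
    intro n w hw
    refine le_of_tendsto (hgl n w hw).norm ?_
    filter_upwards [eventually_ge_atTop n] with N hN
    refine FF_bound hiso (by linarith) g hM' N w ?_
    obtain ⟨k, rfl⟩ := Nat.exists_eq_add_of_le hN
    rw [pow_add, pow_mul, hw, one_pow]
  rw [Metric.tendsto_atTop]
  intro ε hε
  set B := p * M' + p * M with hB
  have hB0 : 0 < B := by positivity
  obtain ⟨n1, h1⟩ := unif hf fl hfl (ε := ε / 2 / B) (by positivity)
  obtain ⟨n2, h2⟩ := unif hg gl hgl (ε := ε / 2 / B) (by positivity)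
  refine ⟨max n1 n2, fun n hn => ?_⟩
  rw [dist_zero_right, AA_fourier C hC hCcard, ← Finset.sum_sub_distrib]
  refine lt_of_le_of_lt (b := ε / 2) ?_ (by linarith)
  refine IsUltrametricDist.norm_sum_le_of_forall_le_of_nonneg (by positivity) fun w hw => ?_
  rw [hC] at hw
  have a1 := h1 n ((le_max_left _ _).trans hn) w hw
  have a2 := h2 n ((le_max_right _ _).trans hn) w hw
  have a3 := FF_bound hiso (by linarith) f hM n w hw
  have a4 := hgb n w hw
  rw [← sub_mul, norm_mul, norm_phi hw, mul_one]
  calc _ = ‖(fl w - FF n f w) * gl w + FF n f w * (gl w - FF n g w)‖ := by congr 1; ring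
    _ ≤ ε / 2 / B * (p * M') + p * M * (ε / 2 / B) := by
      refine (norm_add_le _ _).trans ?_
      rw [norm_mul, norm_mul]
      gcongr
    _ = ε / 2 := by
      have : ε / 2 / B * (p * M') + p * M * (ε / 2 / B) = ε / 2 / B * B := by rw [hB]; ring
      rw [this]; field_simp

end P7

/-- The convolution `f *_q g` is well defined and lies in `UD(ℤ_p, K)`. -/
theorem stmt4 {p : ℕ} [Fact p.Prime] {K : Type*} [NormedField K] [CompleteSpace K]
    [IsUltrametricDist K] [Algebra ℚ_[p] K]
    (hiso : ∀ x : ℚ_[p], ‖algebraMap ℚ_[p] K x‖ = ‖x‖)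
    (L : K) (hL0 : 0 < ‖L‖) (hL1 : ‖L‖ < (p : ℝ) ^ (-1 / ((p : ℝ) - 1)))
    (C : ℕ → Finset K) (hC : ∀ n : ℕ, ∀ w : K, w ∈ C n ↔ w ^ p ^ n = 1)
    (hCcard : ∀ n : ℕ, (C n).card = p ^ n)
    (f f' g g' : ℤ_[p] → K)
    (hf : IsUnifDiff f f') (hg : IsUnifDiff g g')
    (fc gc : K → K)
    (hfc : ∀ (n : ℕ) (w : K), w ^ p ^ n = 1 →
      HasIq p L (fun x => phi w n x * qpow L (-x) * f x) (fc w))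
    (hgc : ∀ (n : ℕ) (w : K), w ^ p ^ n = 1 →
      HasIq p L (fun x => phi w n x * qpow L (-x) * g x) (gc w)) :
    ∃ conv : ℤ_[p] → K,
      (∀ x : ℤ_[p], Tendsto (fun n : ℕ => ∑ w ∈ C n, fc w * gc w * phi w⁻¹ n x)
        atTop (nhds (conv x))) ∧
      ∃ h : ℤ_[p] → K, IsUnifDiff conv h := by
  choose! fl0 hfl0 using fun w : {w : K // ∃ n : ℕ, w ^ p ^ n = 1} =>
    (FF_lim hiso hf w.2.choose_spec)
  choose! gl0 hgl0 using fun w : {w : K // ∃ n : ℕ, w ^ p ^ n = 1} =>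
    (FF_lim hiso hg w.2.choose_spec)
  classical
  let fl : K → K := fun w => if hw : ∃ n : ℕ, w ^ p ^ n = 1 then fl0 ⟨w, hw⟩ else 0
  let gl : K → K := fun w => if hw : ∃ n : ℕ, w ^ p ^ n = 1 then gl0 ⟨w, hw⟩ else 0
  have hfl : ∀ (n : ℕ) (w : K), w ^ p ^ n = 1 →
      Tendsto (fun N => FF N f w) atTop (𝓝 (fl w)) := by
    intro n w hw
    have hw' : ∃ n : ℕ, w ^ p ^ n = 1 := ⟨n, hw⟩
    simp only [fl, dif_pos hw']
    exact hfl0 ⟨w, hw'⟩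
  have hgl : ∀ (n : ℕ) (w : K), w ^ p ^ n = 1 →
      Tendsto (fun N => FF N g w) atTop (𝓝 (gl w)) := by
    intro n w hw
    have hw' : ∃ n : ℕ, w ^ p ^ n = 1 := ⟨n, hw⟩
    simp only [gl, dif_pos hw']
    exact hgl0 ⟨w, hw'⟩
  choose h hh using AA_lim hiso C hC hCcard hf hg
  obtain ⟨h', hh'⟩ := h_UD hiso C hC hCcard hf hg hh
  set c : K := (-L)⁻¹ * (1 - pExp L) with hc
  refine ⟨fun x => (c * c) * h x, fun x => ?_, _, UD_smul hh' (c * c)⟩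
  have h1 := ((sum_close hiso C hC hCcard hf hg fl gl hfl hgl x).add (hh x)).const_mul (c * c)
  rw [zero_add] at h1
  refine h1.congr fun n => ?_
  rw [sub_add_cancel, Finset.mul_sum]
  refine Finset.sum_congr rfl fun w hw => ?_
  rw [hC] at hw
  rw [fc_eq hiso L hL0 hL1 hw (hfc n w hw) (hfl n w hw),
    fc_eq hiso L hL0 hL1 hw (hgc n w hw) (hgl n w hw), ← hc]
  ring
end

section
/- If f : ℤ_p → K is uniformly differentiable with derivative f', then the p-adic q-integral of f exists; that is, the sequence N ↦ (1/[p^N]) · Σ_{x=0}^{p^N-1} f(x) q^x converges in K. -/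
open Filter Topology

section aux

variable {p : ℕ} [Fact p.Prime] {K : Type*} [NormedField K]

lemma aux_add [IsUltrametricDist K] {a b : K} {C : ℝ} (ha : ‖a‖ ≤ C) (hb : ‖b‖ ≤ C) :
    ‖a + b‖ ≤ C :=
  (IsUltrametricDist.norm_add_le_max a b).trans (max_le ha hb)

lemma aux_block (g : ℕ → K) (a b : ℕ) :
    ∑ x ∈ Finset.range (a * b), g x =
      ∑ j ∈ Finset.range b, ∑ x ∈ Finset.range a, g (x + a * j) := by
  induction b with
  | zero => simp
  | succ b ih =>
    rw [Nat.mul_succ, Finset.sum_range_add, ih, Finset.sum_range_succ]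
    congr 1
    exact Finset.sum_congr rfl fun x _ => by rw [add_comm]

lemma aux_natnorm [Algebra ℚ_[p] K] (hiso : ∀ x : ℚ_[p], ‖algebraMap ℚ_[p] K x‖ = ‖x‖) (n : ℕ) :
    ‖(n : K)‖ = ‖(n : ℚ_[p])‖ := by
  rw [← hiso, map_natCast]

lemma aux_natnorm_le [Algebra ℚ_[p] K] (hiso : ∀ x : ℚ_[p], ‖algebraMap ℚ_[p] K x‖ = ‖x‖)
    (n : ℕ) : ‖(n : K)‖ ≤ 1 := by
  rw [aux_natnorm hiso]
  have h := PadicInt.norm_le_one (n : ℤ_[p])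
  rwa [PadicInt.norm_def, PadicInt.coe_natCast] at h

lemma aux_pnorm [Algebra ℚ_[p] K] (hiso : ∀ x : ℚ_[p], ‖algebraMap ℚ_[p] K x‖ = ‖x‖) :
    ‖(p : K)‖ = (p : ℝ)⁻¹ := by
  rw [aux_natnorm hiso, Padic.norm_p]

lemma aux_emb [Algebra ℚ_[p] K] (hiso : ∀ x : ℚ_[p], ‖algebraMap ℚ_[p] K x‖ = ‖x‖) (x : ℤ_[p]) :
    ‖(emb x : K)‖ = ‖x‖ := by
  rw [emb, hiso]; rfl

lemma aux_fact [Algebra ℚ_[p] K] (hiso : ∀ x : ℚ_[p], ‖algebraMap ℚ_[p] K x‖ = ‖x‖) (n : ℕ) :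
    ‖((n.factorial : K))⁻¹‖ ≤ ((p : ℝ) ^ (1 / ((p : ℝ) - 1))) ^ n := by
  have hp : p.Prime := Fact.out
  have hp1 : (1 : ℝ) < p := by exact_mod_cast hp.one_lt
  have hp1' : (0 : ℝ) < (p : ℝ) - 1 := by linarith
  have h0 : (n.factorial : ℚ_[p]) ≠ 0 := Nat.cast_ne_zero.2 (Nat.factorial_ne_zero _)
  rw [norm_inv, aux_natnorm hiso, Padic.norm_eq_zpow_neg_valuation h0, zpow_neg, inv_inv,
    Padic.valuation_natCast, zpow_natCast, ← Real.rpow_natCast, ← Real.rpow_natCast,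
    ← Real.rpow_mul (by linarith)]
  apply Real.rpow_le_rpow_of_exponent_le hp1.le
  have h := sub_one_mul_padicValNat_factorial (p := p) n
  have h2 : (p - 1) * padicValNat p n.factorial ≤ n := by omega
  have h3 : ((p : ℝ) - 1) * (padicValNat p n.factorial : ℝ) ≤ n := by
    have := (Nat.cast_le (α := ℝ)).2 h2
    rwa [Nat.cast_mul, Nat.cast_sub hp.one_lt.le, Nat.cast_one] at this
  rw [one_div, ← div_eq_inv_mul, le_div_iff₀ hp1']
  linarith

/-- good exponent domain -/
def auxGood (K : Type*) [NormedField K] (ρ : ℝ) (x : K) : Prop :=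
  ∀ n : ℕ, ‖((n.factorial : K))⁻¹ * x ^ n‖ ≤ ρ ^ n

lemma aux_summ {ρ : ℝ} (h0 : 0 ≤ ρ) (h1 : ρ < 1) {x : K} (hx : auxGood K ρ x) :
    Summable fun n : ℕ => ‖((n.factorial : K))⁻¹ * x ^ n‖ :=
  Summable.of_nonneg_of_le (fun _ => norm_nonneg _) hx (summable_geometric_of_lt_one h0 h1)

lemma aux_exp_add [CharZero K] [CompleteSpace K] {ρ : ℝ} (h0 : 0 ≤ ρ) (h1 : ρ < 1) {x y : K}
    (hx : auxGood K ρ x) (hy : auxGood K ρ y) : pExp (x + y) = pExp x * pExp y := by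
  unfold pExp
  have hsx := aux_summ h0 h1 hx
  have hsy := aux_summ h0 h1 hy
  rw [tsum_mul_tsum_eq_tsum_sum_antidiagonal_of_summable_norm
    (f := fun n : ℕ => ((n.factorial : K))⁻¹ * x ^ n)
    (g := fun n : ℕ => ((n.factorial : K))⁻¹ * y ^ n) hsx hsy]
  congr 1
  ext n
  rw [(Commute.all x y).add_pow', Finset.mul_sum]
  refine Finset.sum_congr rfl fun m hm => ?_
  have hm' := Finset.HasAntidiagonal.mem_antidiagonal.1 hm
  have hc := Nat.add_choose_mul_factorial_mul_factorial m.1 m.2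
  rw [hm', Nat.choose_symm_of_eq_add (by omega : n = m.2 + m.1)] at hc
  have hc' : (n.factorial : K) = n.choose m.1 * m.1.factorial * m.2.factorial := by
    rw [← hc]; push_cast; rfl
  have e1 : (m.1.factorial : K) ≠ 0 := Nat.cast_ne_zero.2 (Nat.factorial_ne_zero _)
  have e2 : (m.2.factorial : K) ≠ 0 := Nat.cast_ne_zero.2 (Nat.factorial_ne_zero _)
  have e3 : (n.factorial : K) ≠ 0 := Nat.cast_ne_zero.2 (Nat.factorial_ne_zero _)
  rw [nsmul_eq_mul]
  field_simp
  rw [hc']; ring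

lemma aux_exp_two [CompleteSpace K] [IsUltrametricDist K] {ρ : ℝ} (h0 : 0 ≤ ρ) (h1 : ρ < 1) {x : K}
    (hx : auxGood K ρ x) {C : ℝ} (hC : 0 ≤ C)
    (hb : ∀ n : ℕ, ‖(((n + 2).factorial : K))⁻¹ * x ^ (n + 2)‖ ≤ C) :
    ‖pExp x - 1 - x‖ ≤ C := by
  have hs : Summable fun n : ℕ => ((n.factorial : K))⁻¹ * x ^ n := (aux_summ h0 h1 hx).of_norm
  have := hs.sum_add_tsum_nat_add 2
  have e : pExp x - 1 - x = ∑' n : ℕ, (((n + 2).factorial : K))⁻¹ * x ^ (n + 2) := by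
    unfold pExp
    rw [← this]
    simp [Finset.sum_range_succ]
    ring
  rw [e]
  exact IsUltrametricDist.norm_tsum_le_of_forall_le_of_nonneg hC hb

lemma aux_qpow [CompleteSpace K] [IsUltrametricDist K] [Algebra ℚ_[p] K]
    (hiso : ∀ x : ℚ_[p], ‖algebraMap ℚ_[p] K x‖ = ‖x‖)
    (L : K) (hL1 : ‖L‖ < (p : ℝ) ^ (-1 / ((p : ℝ) - 1))) :
    ‖L‖ ≤ 1 ∧ (∀ x y : ℤ_[p], qpow L (x + y) = qpow L x * qpow L y) ∧
    (∀ x : ℤ_[p], ‖qpow L x‖ ≤ 1) ∧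
    (∀ x : ℤ_[p], ‖qpow L x - 1 - emb x * L‖ ≤ ‖x‖ ^ 2) := by
  have hp : p.Prime := Fact.out
  have hp1 : (1 : ℝ) < p := by exact_mod_cast hp.one_lt
  have hcz : CharZero K := charZero_of_injective_algebraMap (algebraMap ℚ_[p] K).injective
  set c : ℝ := (p : ℝ) ^ (1 / ((p : ℝ) - 1)) with hc
  have hc1 : 1 ≤ c := Real.one_le_rpow hp1.le (by apply div_nonneg <;> linarith)
  have hLc : ‖L‖ < c⁻¹ := by
    rw [hc, ← Real.rpow_neg (by linarith)]
    convert hL1 using 2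
    ring
  set ρ : ℝ := c * ‖L‖ with hρ
  have h0 : 0 ≤ ρ := by positivity
  have h1 : ρ < 1 := by
    have := mul_lt_mul_of_pos_left hLc (by linarith : 0 < c)
    rwa [mul_inv_cancel₀ (by linarith)] at this
  have key : ∀ (x : ℤ_[p]) (n : ℕ),
      ‖((n.factorial : K))⁻¹ * (emb x * L) ^ n‖ ≤ ρ ^ n * ‖x‖ ^ n := by
    intro x n
    rw [norm_mul, norm_pow, norm_mul, aux_emb hiso, mul_pow, hρ, mul_pow]
    calc _ ≤ c ^ n * (‖x‖ ^ n * ‖L‖ ^ n) :=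
          mul_le_mul_of_nonneg_right (aux_fact hiso n) (by positivity)
      _ = _ := by ring
  have good : ∀ x : ℤ_[p], auxGood K ρ (emb x * L) := fun x n =>
    (key x n).trans (mul_le_of_le_one_right (by positivity)
      (pow_le_one₀ (norm_nonneg _) (PadicInt.norm_le_one x)))
  refine ⟨hLc.le.trans (inv_le_one_of_one_le₀ hc1), fun x y => ?_, fun x => ?_, fun x => ?_⟩
  · unfold qpow
    rw [← aux_exp_add h0 h1 (good x) (good y)]
    congr 1
    simp [emb, add_mul]
  · exact IsUltrametricDist.norm_tsum_le_of_forall_le_of_nonneg zero_le_one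
      fun n => (good x n).trans (pow_le_one₀ h0 h1.le)
  · refine aux_exp_two h0 h1 (good x) (by positivity) fun n => (key x _).trans ?_
    have a1 : ρ ^ (n + 2) ≤ 1 := pow_le_one₀ h0 h1.le
    have a2 : ‖x‖ ^ (n + 2) ≤ ‖x‖ ^ 2 :=
      pow_le_pow_of_le_one (norm_nonneg _) (PadicInt.norm_le_one x) (by omega)
    calc _ ≤ 1 * ‖x‖ ^ 2 := mul_le_mul a1 a2 (by positivity) zero_le_one
      _ = _ := one_mul _

/-- multiplicative form of uniform differentiability -/
def auxUD {p : ℕ} [Fact p.Prime] {K : Type*} [NormedField K] [Algebra ℚ_[p] K]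
    (f f' : ℤ_[p] → K) : Prop :=
  ∀ ε : ℝ, 0 < ε → ∃ δ : ℝ, 0 < δ ∧ ∀ x y : ℤ_[p], ‖x - y‖ ≤ δ →
    ‖f x - f y - emb (x - y) * f' y‖ ≤ ε * ‖x - y‖

lemma aux_ud [Algebra ℚ_[p] K] (hiso : ∀ x : ℚ_[p], ‖algebraMap ℚ_[p] K x‖ = ‖x‖)
    {f f' : ℤ_[p] → K} (hf : IsUnifDiff f f') : auxUD f f' := by
  intro ε hε
  obtain ⟨δ, hδ, h⟩ := hf ε hε
  refine ⟨δ, hδ, fun x y hxy => ?_⟩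
  rcases eq_or_ne x y with rfl | hne
  · simp [emb]
  have hpos : 0 < ‖x - y‖ := norm_pos_iff.2 (sub_ne_zero.2 hne)
  have h1 := h x y hpos hxy
  have hne : (emb (x - y) : K) ≠ 0 := by
    rw [← norm_pos_iff, aux_emb hiso]; exact hpos
  have e : f x - f y - emb (x - y) * f' y =
      ((f x - f y) / emb (x - y) - f' y) * emb (x - y) := by
    field_simp
  rw [e, norm_mul, aux_emb hiso]
  exact mul_le_mul_of_nonneg_right h1 hpos.le

lemma aux_der_cont [IsUltrametricDist K] [Algebra ℚ_[p] K]
    (hiso : ∀ x : ℚ_[p], ‖algebraMap ℚ_[p] K x‖ = ‖x‖)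
    {f f' : ℤ_[p] → K} (hf : auxUD f f') :
    ∀ ε : ℝ, 0 < ε → ∃ δ : ℝ, 0 < δ ∧ ∀ x y : ℤ_[p], ‖x - y‖ ≤ δ → ‖f' x - f' y‖ ≤ ε := by
  intro ε hε
  obtain ⟨δ, hδ, h⟩ := hf ε hε
  refine ⟨δ, hδ, fun x y hxy => ?_⟩
  rcases eq_or_ne x y with rfl | hne
  · simp [hε.le]
  have hpos : 0 < ‖x - y‖ := norm_pos_iff.2 (sub_ne_zero.2 hne)
  have h1 := h x y hxy
  have h2 := h y x (by rwa [norm_sub_rev])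
  rw [norm_sub_rev y x] at h2
  have h3 := aux_add h1 h2
  have e : f x - f y - emb (x - y) * f' y + (f y - f x - emb (y - x) * f' x) =
      emb (x - y) * (f' x - f' y) := by
    simp [emb]; ring
  rw [e, norm_mul, aux_emb hiso, mul_comm] at h3
  exact le_of_mul_le_mul_right h3 hpos

lemma aux_bdd_of_cont {f : ℤ_[p] → K} (hf : Continuous f) : ∃ B : ℝ, ∀ x, ‖f x‖ ≤ B := by
  obtain ⟨B, hB⟩ := isCompact_univ.exists_bound_of_continuousOn hf.continuousOn
  exact ⟨B, fun x => hB x trivial⟩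

lemma aux_der_bdd [IsUltrametricDist K] [Algebra ℚ_[p] K]
    (hiso : ∀ x : ℚ_[p], ‖algebraMap ℚ_[p] K x‖ = ‖x‖)
    {f f' : ℤ_[p] → K} (hf : auxUD f f') : ∃ B : ℝ, ∀ x, ‖f' x‖ ≤ B := by
  apply aux_bdd_of_cont
  rw [Metric.continuous_iff]
  intro b ε hε
  obtain ⟨δ, hδ, h⟩ := aux_der_cont hiso hf (ε / 2) (by positivity)
  refine ⟨δ, hδ, fun a ha => ?_⟩
  rw [dist_eq_norm] at ha ⊢
  linarith [h a b ha.le]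

lemma aux_fun_bdd [IsUltrametricDist K] [Algebra ℚ_[p] K]
    (hiso : ∀ x : ℚ_[p], ‖algebraMap ℚ_[p] K x‖ = ‖x‖)
    {f f' : ℤ_[p] → K} (hf : auxUD f f') : ∃ B : ℝ, ∀ x, ‖f x‖ ≤ B := by
  obtain ⟨B, hB⟩ := aux_der_bdd hiso hf
  have hB0 : 0 ≤ B := (norm_nonneg _).trans (hB 0)
  apply aux_bdd_of_cont
  rw [Metric.continuous_iff]
  intro b ε hε
  obtain ⟨δ, hδ, h⟩ := hf 1 one_pos
  refine ⟨min δ (ε / (1 + B)), by positivity, fun a ha => ?_⟩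
  rw [dist_eq_norm] at ha ⊢
  have h1 := h a b (ha.le.trans (min_le_left _ _))
  have h2 : ‖a - b‖ < ε / (1 + B) := ha.trans_le (min_le_right _ _)
  rw [lt_div_iff₀ (by positivity)] at h2
  have h3 : ‖emb (a - b) * f' b‖ ≤ ‖a - b‖ * B := by
    rw [norm_mul, aux_emb hiso]
    exact mul_le_mul_of_nonneg_left (hB b) (norm_nonneg _)
  have := norm_add_le (f a - f b - emb (a - b) * f' b) (emb (a - b) * f' b)
  rw [sub_add_cancel] at this
  linarith

lemma aux_prod [CompleteSpace K] [IsUltrametricDist K] [Algebra ℚ_[p] K]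
    (hiso : ∀ x : ℚ_[p], ‖algebraMap ℚ_[p] K x‖ = ‖x‖)
    (L : K) (hL1 : ‖L‖ < (p : ℝ) ^ (-1 / ((p : ℝ) - 1)))
    {f f' : ℤ_[p] → K} (hf : auxUD f f') :
    auxUD (fun x => f x * qpow L x) (fun x => f' x * qpow L x + f x * (L * qpow L x)) := by
  obtain ⟨hL, hadd, hle, h2⟩ := aux_qpow hiso L hL1
  obtain ⟨B, hB⟩ := aux_fun_bdd hiso hf
  obtain ⟨B', hB'⟩ := aux_der_bdd hiso hf
  have hB0 : 0 ≤ B := (norm_nonneg _).trans (hB 0)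
  have hB0' : 0 ≤ B' := (norm_nonneg _).trans (hB' 0)
  intro ε hε
  obtain ⟨δ, hδ, h⟩ := hf ε hε
  refine ⟨min δ (ε / (1 + B + B')), by positivity, fun x y hxy => ?_⟩
  have h1 := h x y (hxy.trans (min_le_left _ _))
  have h3 : ‖x - y‖ ≤ ε / (1 + B + B') := hxy.trans (min_le_right _ _)
  rw [le_div_iff₀ (by positivity)] at h3
  have hx : qpow L x = qpow L y * qpow L (x - y) := by
    rw [← hadd, add_sub_cancel]
  have hu0 := norm_nonneg (x - y)
  have hu1 := PadicInt.norm_le_one (x - y)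
  have hQ2 := h2 (x - y)
  have hQ1 : ‖qpow L (x - y) - 1‖ ≤ ‖x - y‖ := by
    have : qpow L (x - y) - 1 = (qpow L (x - y) - 1 - emb (x - y) * L) + emb (x - y) * L := by ring
    rw [this]
    refine aux_add (hQ2.trans (by nlinarith)) ?_
    rw [norm_mul, aux_emb hiso]
    exact mul_le_of_le_one_right hu0 hL
  have e : f x * qpow L x - f y * qpow L y -
      emb (x - y) * (f' y * qpow L y + f y * (L * qpow L y)) =
      qpow L y * ((f x - f y - emb (x - y) * f' y) * qpow L (x - y) +
        emb (x - y) * f' y * (qpow L (x - y) - 1) +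
        f y * (qpow L (x - y) - 1 - emb (x - y) * L)) := by
    rw [hx]; ring
  simp only []
  rw [e, norm_mul]
  refine (mul_le_of_le_one_left (norm_nonneg _) (hle y)).trans ?_
  refine aux_add (aux_add ?_ ?_) ?_
  · rw [norm_mul]
    exact (mul_le_of_le_one_right (norm_nonneg _) (hle _)).trans h1
  · rw [norm_mul, norm_mul, aux_emb hiso]
    calc _ ≤ ‖x - y‖ * B' * ‖x - y‖ := by gcongr; exact hB' y
      _ ≤ _ := by
        apply mul_le_mul_of_nonneg_right _ hu0
        nlinarith [mul_nonneg hu0 hB0]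
  · rw [norm_mul]
    calc _ ≤ B * ‖x - y‖ ^ 2 := by gcongr; exact hB y
      _ = B * ‖x - y‖ * ‖x - y‖ := by ring
      _ ≤ _ := by
        apply mul_le_mul_of_nonneg_right _ hu0
        nlinarith [mul_nonneg hu0 hB0']

lemma aux_small {δ : ℝ} (hδ : 0 < δ) :
    ∃ M : ℕ, ∀ N ≥ M, ∀ x j : ℕ, ‖((x + p ^ N * j : ℕ) : ℤ_[p]) - (x : ℤ_[p])‖ ≤ δ := by
  have hp : p.Prime := Fact.out
  have hp1 : (1 : ℝ) < p := by exact_mod_cast hp.one_lt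
  obtain ⟨M, hM⟩ := exists_pow_lt_of_lt_one hδ (inv_lt_one_of_one_lt₀ hp1)
  refine ⟨M, fun N hN x j => ?_⟩
  push_cast
  rw [add_sub_cancel_left, norm_mul, norm_pow, PadicInt.norm_p]
  refine (mul_le_of_le_one_right (by positivity) (PadicInt.norm_le_one _)).trans ?_
  exact (pow_le_pow_of_le_one (by positivity) (inv_le_one_of_one_le₀ hp1.le) hN).trans hM.le

lemma aux_sum_zero [IsUltrametricDist K] [Algebra ℚ_[p] K]
    (hiso : ∀ x : ℚ_[p], ‖algebraMap ℚ_[p] K x‖ = ‖x‖) {h : ℤ_[p] → K}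
    (hh : ∀ ε : ℝ, 0 < ε → ∃ δ : ℝ, 0 < δ ∧ ∀ x y : ℤ_[p], ‖x - y‖ ≤ δ → ‖h x - h y‖ ≤ ε)
    {ε : ℝ} (hε : 0 < ε) :
    ∃ N₀ : ℕ, ∀ N ≥ N₀, ‖∑ x ∈ Finset.range (p ^ N), h (x : ℤ_[p])‖ ≤ ε := by
  have hp : p.Prime := Fact.out
  have hp1 : (1 : ℝ) < p := by exact_mod_cast hp.one_lt
  obtain ⟨δ, hδ, hd⟩ := hh ε hε
  obtain ⟨M, hM⟩ := aux_small (p := p) hδ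
  set S := ∑ x ∈ Finset.range (p ^ M), h (x : ℤ_[p]) with hS
  obtain ⟨k₀, hk₀⟩ := exists_pow_lt_of_lt_one (show 0 < ε / (1 + ‖S‖) by positivity)
    (inv_lt_one_of_one_lt₀ hp1)
  refine ⟨M + k₀, fun N hN => ?_⟩
  obtain ⟨k, rfl⟩ : ∃ k, N = M + k := ⟨N - M, by omega⟩
  have hk : k₀ ≤ k := by omega
  have e : ∑ x ∈ Finset.range (p ^ (M + k)), h (x : ℤ_[p]) =
      ∑ j ∈ Finset.range (p ^ k), ∑ x ∈ Finset.range (p ^ M),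
        (h ((x + p ^ M * j : ℕ) : ℤ_[p]) - h (x : ℤ_[p])) + (p : K) ^ k * S := by
    rw [pow_add, aux_block (fun x => h (x : ℤ_[p]))]
    simp only [Finset.sum_sub_distrib, ← hS, Finset.sum_const, Finset.card_range, nsmul_eq_mul]
    push_cast
    ring
  rw [e]
  refine aux_add ?_ ?_
  · refine IsUltrametricDist.norm_sum_le_of_forall_le_of_nonneg hε.le fun j _ =>
      IsUltrametricDist.norm_sum_le_of_forall_le_of_nonneg hε.le fun x _ => ?_
    exact hd _ _ (hM M le_rfl x j)
  · rw [norm_mul, norm_pow, aux_pnorm hiso]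
    have := (pow_le_pow_of_le_one (by positivity) (inv_le_one_of_one_le₀ hp1.le) hk).trans hk₀.le
    rw [le_div_iff₀ (by positivity)] at this
    have h3 : (0 : ℝ) ≤ (p : ℝ)⁻¹ ^ k := by positivity
    linarith

lemma aux_volk [CompleteSpace K] [IsUltrametricDist K] [Algebra ℚ_[p] K]
    (hiso : ∀ x : ℚ_[p], ‖algebraMap ℚ_[p] K x‖ = ‖x‖) {g g' : ℤ_[p] → K} (hg : auxUD g g') :
    ∃ I : K, Tendsto (fun N : ℕ => ((p : K) ^ N)⁻¹ *
      ∑ x ∈ Finset.range (p ^ N), g (x : ℤ_[p])) atTop (nhds I) := by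
  have hp : p.Prime := Fact.out
  have hp0 : (0 : ℝ) < p := by exact_mod_cast hp.pos
  have hpn := aux_pnorm hiso
  have hpK : (p : K) ≠ 0 := by
    rw [← norm_pos_iff, hpn]; positivity
  apply cauchySeq_tendsto_of_complete
  apply NonarchimedeanAddGroup.cauchySeq_of_tendsto_sub_nhds_zero
  rw [Metric.tendsto_atTop]
  intro ε₀ hε₀
  set ε := ε₀ / (2 * p) with hεd
  have hε : 0 < ε := by positivity
  obtain ⟨δ, hδ, hd⟩ := hg ε hε
  obtain ⟨M, hM⟩ := aux_small (p := p) hδ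
  obtain ⟨N₀, hN₀⟩ := aux_sum_zero hiso (aux_der_cont hiso hg) hε
  refine ⟨max M N₀, fun N hN => ?_⟩
  have hNM : M ≤ N := (le_max_left _ _).trans hN
  have hNN : N₀ ≤ N := (le_max_right _ _).trans hN
  rw [dist_zero_right]
  suffices h : ‖((p : K) ^ (N + 1))⁻¹ * ∑ x ∈ Finset.range (p ^ (N + 1)), g (x : ℤ_[p]) -
      ((p : K) ^ N)⁻¹ * ∑ x ∈ Finset.range (p ^ N), g (x : ℤ_[p])‖ ≤ p * ε by
    refine h.trans_lt ?_
    rw [hεd]; field_simp; norm_num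
  have e : ((p : K) ^ (N + 1))⁻¹ * ∑ x ∈ Finset.range (p ^ (N + 1)), g (x : ℤ_[p]) -
      ((p : K) ^ N)⁻¹ * ∑ x ∈ Finset.range (p ^ N), g (x : ℤ_[p]) =
      ((p : K) ^ (N + 1))⁻¹ * (∑ j ∈ Finset.range p, ∑ x ∈ Finset.range (p ^ N),
        (g ((x + p ^ N * j : ℕ) : ℤ_[p]) - g (x : ℤ_[p]) - (p : K) ^ N * j * g' (x : ℤ_[p]))) +
      (p : K)⁻¹ * (((∑ j ∈ Finset.range p, j : ℕ) : K) *
        ∑ x ∈ Finset.range (p ^ N), g' (x : ℤ_[p])) := by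
    rw [pow_succ p N, aux_block (fun x => g (x : ℤ_[p]))]
    simp only [Finset.sum_sub_distrib, ← Finset.mul_sum, ← Finset.sum_mul, Finset.sum_const,
      Finset.card_range, nsmul_eq_mul, Nat.cast_sum]
    field_simp
    ring
  rw [e]
  refine aux_add ?_ ?_
  · rw [norm_mul, norm_inv, norm_pow, hpn]
    have : ‖∑ j ∈ Finset.range p, ∑ x ∈ Finset.range (p ^ N),
        (g ((x + p ^ N * j : ℕ) : ℤ_[p]) - g (x : ℤ_[p]) - (p : K) ^ N * j * g' (x : ℤ_[p]))‖ ≤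
        ε * (p : ℝ)⁻¹ ^ N := by
      refine IsUltrametricDist.norm_sum_le_of_forall_le_of_nonneg (by positivity) fun j _ =>
        IsUltrametricDist.norm_sum_le_of_forall_le_of_nonneg (by positivity) fun x _ => ?_
      have h1 := hd _ _ (hM N hNM x j)
      have e1 : ((x + p ^ N * j : ℕ) : ℤ_[p]) - (x : ℤ_[p]) = (p : ℤ_[p]) ^ N * (j : ℤ_[p]) := by
        push_cast; ring
      have e2 : (emb ((p : ℤ_[p]) ^ N * (j : ℤ_[p])) : K) = (p : K) ^ N * j := by
        simp [emb]
      rw [e1, e2] at h1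
      refine h1.trans ?_
      apply mul_le_mul_of_nonneg_left _ hε.le
      rw [norm_mul, norm_pow, PadicInt.norm_p]
      exact mul_le_of_le_one_right (by positivity) (PadicInt.norm_le_one _)
    calc _ ≤ ((p : ℝ)⁻¹ ^ (N + 1))⁻¹ * (ε * (p : ℝ)⁻¹ ^ N) := by gcongr
      _ = p * ε := by rw [inv_pow, inv_pow, inv_inv, pow_succ]; field_simp
  · rw [norm_mul, norm_inv, hpn, inv_inv, norm_mul]
    apply mul_le_mul_of_nonneg_left _ hp0.le
    exact (mul_le_of_le_one_left (norm_nonneg _) (aux_natnorm_le hiso _)).trans (hN₀ N hNN)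

end aux

/-- If `f ∈ UD(ℤ_p, K)`, then the `p`-adic `q`-integral `I_q(f)` exists. -/
theorem stmt6 {p : ℕ} [Fact p.Prime] {K : Type*} [NormedField K] [CompleteSpace K]
    [IsUltrametricDist K] [Algebra ℚ_[p] K]
    (hiso : ∀ x : ℚ_[p], ‖algebraMap ℚ_[p] K x‖ = ‖x‖)
    (L : K) (hL0 : 0 < ‖L‖) (hL1 : ‖L‖ < (p : ℝ) ^ (-1 / ((p : ℝ) - 1)))
    (f f' : ℤ_[p] → K) (hf : IsUnifDiff f f') :
    ∃ I : K, HasIq p L f I := by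
  have hp : p.Prime := Fact.out
  have hp1 : (1 : ℝ) < p := by exact_mod_cast hp.one_lt
  obtain ⟨I, hI⟩ := aux_volk hiso (aux_prod hiso L hL1 (aux_ud hiso hf))
  obtain ⟨-, -, -, h2⟩ := aux_qpow hiso L hL1
  have hL : L ≠ 0 := norm_pos_iff.1 hL0
  have hpn := aux_pnorm hiso
  have hpK : (p : K) ≠ 0 := by
    rw [← norm_pos_iff, hpn]; positivity
  have hlim : Tendsto (fun N : ℕ => (qpow L ((p : ℤ_[p]) ^ N) - 1) / (p : K) ^ N) atTop
      (nhds L) := by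
    rw [tendsto_iff_norm_sub_tendsto_zero]
    refine squeeze_zero (fun _ => norm_nonneg _) (fun N => ?_)
      (tendsto_pow_atTop_nhds_zero_of_lt_one (r := (p : ℝ)⁻¹) (by positivity)
        (inv_lt_one_of_one_lt₀ hp1))
    have h := h2 ((p : ℤ_[p]) ^ N)
    have e2 : (emb ((p : ℤ_[p]) ^ N) : K) = (p : K) ^ N := by
      simp [emb]
    rw [e2, norm_pow, PadicInt.norm_p] at h
    have e : (qpow L ((p : ℤ_[p]) ^ N) - 1) / (p : K) ^ N - L =
        (qpow L ((p : ℤ_[p]) ^ N) - 1 - (p : K) ^ N * L) / (p : K) ^ N := by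
      field_simp
    rw [e, norm_div, norm_pow, hpn, div_le_iff₀ (by positivity), ← sq]
    exact h
  refine ⟨(pExp L - 1) * (L⁻¹ * I), ?_⟩
  unfold HasIq
  refine (((hlim.inv₀ hL).mul hI).const_mul (pExp L - 1)).congr fun N => ?_
  have hpN : (p : K) ^ N ≠ 0 := pow_ne_zero _ hpK
  have e : (qbracket p L N)⁻¹ =
      (pExp L - 1) * ((qpow L ((p : ℤ_[p]) ^ N) - 1) / (p : K) ^ N)⁻¹ * ((p : K) ^ N)⁻¹ := by
    unfold qbracket
    rw [inv_div, inv_div, ← neg_sub (pExp L) 1, ← neg_sub (qpow L ((p : ℤ_[p]) ^ N)) 1,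
      neg_div_neg_eq, div_eq_mul_inv, div_eq_mul_inv]
    field_simp
  rw [e]
  ring
end

section
/- Let n ∈ ℕ, let ξ ∈ C_{p^n}, and let t ∈ K with ‖t‖ < p^{-1/(p-1)} and q·ξ·exp(t) ≠ 1. Then the p-adic q-integral of x ↦ exp(t·x)·φ_ξ(x) exists and I_q(x ↦ exp(t·x) φ_ξ(x)) = ((q-1)/L) · (t + L)/(q·ξ·exp(t) - 1); that is, lim_{N→∞} (1/[p^N]) Σ_{x=0}^{p^N-1} exp(t·x) ξ^x q^x = ((q-1)/L)·(t+L)/(q ξ exp(t) - 1). (Under Kim's normalization of dμ_q this is the formula ∫_X e^{tx} φ_ξ(x) dμ_q(x) = (t + log q)/(q ξ e^t - 1), up to the normalizing constant (q-1)/log q.) -/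
open Filter Topology

theorem pExp_eq (p : ℕ) [Fact p.Prime] {K : Type*} [NormedField K] [NormedAlgebra ℚ_[p] K] (x : K) :
    pExp x = NormedSpace.exp x := by
  rw [NormedSpace.exp_eq_tsum ℚ_[p], pExp]
  refine tsum_congr fun n => ?_
  rw [Algebra.smul_def, map_inv₀, map_natCast]

theorem radius_bound (p : ℕ) [hp : Fact p.Prime] (K : Type*) [NormedField K]
    [NormedAlgebra ℚ_[p] K] :
    ENNReal.ofReal ((p : ℝ) ^ (-1 / ((p : ℝ) - 1))) ≤ (NormedSpace.expSeries ℚ_[p] K).radius := by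
  have hp1 : (1 : ℝ) < p := by exact_mod_cast hp.out.one_lt
  have hp0 : (0 : ℝ) < p := by linarith
  have hr : (0 : ℝ) ≤ (p : ℝ) ^ (-1 / ((p : ℝ) - 1)) := Real.rpow_nonneg hp0.le _
  refine FormalMultilinearSeries.le_radius_of_bound _ 1 fun n => ?_
  rw [Real.coe_toNNReal _ hr, NormedSpace.expSeries, norm_smul,
    ContinuousMultilinearMap.norm_mkPiAlgebraFin, mul_one, norm_inv,
    Padic.norm_eq_zpow_neg_valuation (by exact_mod_cast n.factorial_ne_zero),
    Padic.valuation_natCast, ← Real.rpow_natCast, ← Real.rpow_mul hp0.le,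
    ← Real.rpow_intCast, ← Real.rpow_neg hp0.le, ← Real.rpow_add hp0]
  refine Real.rpow_le_one_of_one_le_of_nonpos hp1.le ?_
  have h1 : (p - 1) * padicValNat p n.factorial ≤ n := by
    rw [sub_one_mul_padicValNat_factorial]; exact Nat.sub_le _ _
  have h2 : ((p : ℝ) - 1) * padicValNat p n.factorial ≤ n := by
    have := (Nat.cast_le (α := ℝ)).2 h1
    rwa [Nat.cast_mul, Nat.cast_sub hp.out.one_le, Nat.cast_one] at this
  have h3 : (padicValNat p n.factorial : ℝ) ≤ n / ((p : ℝ) - 1) := by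
    rw [le_div_iff₀ (by linarith)]; linarith
  rw [Int.cast_neg, Int.cast_natCast]
  have : -1 / ((p : ℝ) - 1) * n = - (n / ((p : ℝ) - 1)) := by ring
  rw [this]; linarith

theorem mem_ball_of (p : ℕ) [hp : Fact p.Prime] {K : Type*} [NormedField K]
    [NormedAlgebra ℚ_[p] K] {x : K} (hx : ‖x‖ < (p : ℝ) ^ (-1 / ((p : ℝ) - 1))) :
    x ∈ Metric.eball (0 : K) (NormedSpace.expSeries ℚ_[p] K).radius := by
  rw [Metric.mem_eball, edist_zero_right]
  refine lt_of_lt_of_le ?_ (radius_bound p K)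
  rw [← ofReal_norm]
  exact (ENNReal.ofReal_lt_ofReal_iff (lt_of_le_of_lt (norm_nonneg x) hx)).2 hx

theorem norm_natmul (p : ℕ) [hp : Fact p.Prime] {K : Type*} [NormedField K]
    [IsUltrametricDist K] (m : ℕ) (x : K) : ‖(m : K) * x‖ ≤ ‖x‖ := by
  rw [norm_mul]
  exact mul_le_of_le_one_left (norm_nonneg _) (IsUltrametricDist.norm_natCast_le_one K m)

theorem pExp_add (p : ℕ) [hp : Fact p.Prime] {K : Type*} [NormedField K] [CompleteSpace K]
    [NormedAlgebra ℚ_[p] K] {x y : K} (hx : ‖x‖ < (p : ℝ) ^ (-1 / ((p : ℝ) - 1)))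
    (hy : ‖y‖ < (p : ℝ) ^ (-1 / ((p : ℝ) - 1))) : pExp (x + y) = pExp x * pExp y := by
  simp only [pExp_eq p]
  exact NormedSpace.exp_add_of_mem_ball (mem_ball_of p hx) (mem_ball_of p hy)

theorem pExp_natmul (p : ℕ) [hp : Fact p.Prime] {K : Type*} [NormedField K] [CompleteSpace K]
    [IsUltrametricDist K] [NormedAlgebra ℚ_[p] K] {x : K}
    (hx : ‖x‖ < (p : ℝ) ^ (-1 / ((p : ℝ) - 1))) (m : ℕ) : pExp ((m : K) * x) = pExp x ^ m := by
  induction m with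
  | zero => simp [pExp_eq p]
  | succ m ih =>
    rw [Nat.cast_succ, add_mul, one_mul, pExp_add p ((norm_natmul p m x).trans_lt hx) hx, ih,
      pow_succ]

theorem pExp_lim (p : ℕ) [hp : Fact p.Prime] {K : Type*} [NormedField K] [CompleteSpace K]
    [NormedAlgebra ℚ_[p] K] (x : K) :
    Tendsto (fun N : ℕ => ((p ^ N : ℕ) : K)⁻¹ * (pExp (((p ^ N : ℕ) : K) * x) - 1))
      atTop (𝓝 x) := by
  have hp1 : (1 : ℝ) < p := by exact_mod_cast hp.out.one_lt
  have hrad : 0 < (NormedSpace.expSeries ℚ_[p] K).radius :=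
    lt_of_lt_of_le (ENNReal.ofReal_pos.2 (Real.rpow_pos_of_pos (by linarith) _)) (radius_bound p K)
  have h1 := (hasStrictFDerivAt_exp_zero_of_radius_pos hrad).hasFDerivAt
  have h2 : HasDerivAt (fun s : ℚ_[p] => s • x) x 0 := by
    simpa using (hasDerivAt_id (0 : ℚ_[p])).smul_const x
  have h3 : HasDerivAt (fun s : ℚ_[p] => NormedSpace.exp (s • x)) x 0 := by
    have h1' : HasFDerivAt NormedSpace.exp (1 : K →L[ℚ_[p]] K) ((0 : ℚ_[p]) • x) := by
      rwa [zero_smul]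
    exact h1'.comp_hasDerivAt (0 : ℚ_[p]) h2
  have h4 := h3.tendsto_slope_zero
  have h5 : Tendsto (fun N : ℕ => (p : ℚ_[p]) ^ N) atTop (𝓝[≠] 0) := by
    refine tendsto_nhdsWithin_iff.2 ⟨tendsto_pow_atTop_nhds_zero_of_norm_lt_one ?_, ?_⟩
    · exact Padic.norm_p_lt_one
    · exact Eventually.of_forall fun N => pow_ne_zero _ (by exact_mod_cast hp.out.ne_zero)
  refine (h4.comp h5).congr fun N => ?_
  simp [pExp_eq p, Algebra.smul_def]

theorem pow_appr {p : ℕ} [Fact p.Prime] {K : Type*} [NormedField K] (n : ℕ) (ξ : K)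
    (hξ : ξ ^ p ^ n = 1) (x : ℕ) : phi ξ n (x : ℤ_[p]) = ξ ^ x := by
  have h : (PadicInt.toZModPow n (x : ℤ_[p])) = ((x : ℤ_[p]).appr n : ZMod (p ^ n)) := rfl
  rw [map_natCast, ZMod.natCast_eq_natCast_iff] at h
  exact (pow_eq_pow_of_modEq h hξ).symm

/-- `∫_X e^{tx} φ_ξ(x) dμ_q(x) = (t + log q)/(q ξ e^t - 1)` up to the normalizing
constant `(q-1)/log q`. -/
theorem stmt7 {p : ℕ} [Fact p.Prime] {K : Type*} [NormedField K] [CompleteSpace K]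
    [IsUltrametricDist K] [Algebra ℚ_[p] K]
    (hiso : ∀ x : ℚ_[p], ‖algebraMap ℚ_[p] K x‖ = ‖x‖)
    (L : K) (hL0 : 0 < ‖L‖) (hL1 : ‖L‖ < (p : ℝ) ^ (-1 / ((p : ℝ) - 1)))
    (n : ℕ) (ξ : K) (hξ : ξ ^ p ^ n = 1)
    (t : K) (ht : ‖t‖ < (p : ℝ) ^ (-1 / ((p : ℝ) - 1)))
    (hne : pExp L * ξ * pExp t ≠ 1) :
    HasIq p L (fun x => pExp (emb x * t) * phi ξ n x)
      (((pExp L - 1) / L) * ((t + L) / (pExp L * ξ * pExp t - 1))) := by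
  letI : NormedAlgebra ℚ_[p] K :=
    { (inferInstance : Algebra ℚ_[p] K) with
      norm_smul_le := fun r x => by rw [Algebra.smul_def, norm_mul, hiso] }
  have hL : L ≠ 0 := norm_pos_iff.1 hL0
  have hemb : ∀ x : ℕ, (emb (x : ℤ_[p]) : K) = x := fun x => by simp [emb]
  set a := pExp L * ξ * pExp t with ha
  have ha1 : a - 1 ≠ 0 := sub_ne_zero.2 hne
  have hterm : ∀ x : ℕ, pExp ((emb (x : ℤ_[p]) : K) * t) * phi ξ n (x : ℤ_[p]) *
      qpow L (x : ℤ_[p]) = a ^ x := fun x => by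
    rw [qpow, hemb, pExp_natmul p ht, pExp_natmul p hL1, pow_appr n ξ hξ, ha]
    ring
  have hlim := (((pExp_lim p L).inv₀ hL).mul (pExp_lim p (L + t))).const_mul
    ((pExp L - 1) * (a - 1)⁻¹)
  have hgoal : (pExp L - 1) * (a - 1)⁻¹ * (L⁻¹ * (L + t)) =
      ((pExp L - 1) / L) * ((t + L) / (a - 1)) := by
    field_simp; ring
  rw [hgoal] at hlim
  refine hlim.congr' ?_
  filter_upwards [eventually_ge_atTop n] with N hN
  have hsum : ∑ x ∈ Finset.range (p ^ N), pExp ((emb (x : ℤ_[p]) : K) * t) * phi ξ n (x : ℤ_[p]) *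
      qpow L (x : ℤ_[p]) = (a ^ p ^ N - 1) / (a - 1) := by
    rw [Finset.sum_congr rfl fun x _ => hterm x, geom_sum_eq hne]
  have hapow : a ^ p ^ N = pExp (((p ^ N : ℕ) : K) * (L + t)) := by
    obtain ⟨k, rfl⟩ := Nat.exists_eq_add_of_le hN
    have hξ' : ξ ^ p ^ (n + k) = 1 := by rw [pow_add, pow_mul, hξ, one_pow]
    rw [mul_add, pExp_add p ((norm_natmul p _ _).trans_lt hL1) ((norm_natmul p _ _).trans_lt ht),
      pExp_natmul p hL1, pExp_natmul p ht, ha, mul_pow, mul_pow, hξ', mul_one]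
  have hbr : qpow L ((p : ℤ_[p]) ^ N) = pExp (((p ^ N : ℕ) : K) * L) := by
    rw [qpow, ← hemb]; push_cast; rfl
  have hpN : ((p ^ N : ℕ) : K) ≠ 0 := by
    rw [← map_natCast (algebraMap ℚ_[p] K)]
    exact (map_ne_zero _).2 (by exact_mod_cast pow_ne_zero _ (Fact.out : p.Prime).ne_zero)
  rw [hsum, qbracket, hbr, hapow, ← neg_sub (pExp _) 1, ← neg_sub (pExp L) 1, neg_div_neg_eq,
    inv_div, mul_inv, inv_inv]
  generalize pExp (((p ^ N : ℕ) : K) * L) - 1 = u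
  generalize pExp (((p ^ N : ℕ) : K) * (L + t)) - 1 = v
  generalize ((p ^ N : ℕ) : K) = w at hpN
  rw [div_eq_mul_inv, div_eq_mul_inv]
  calc _ = (w * w⁻¹) * ((pExp L - 1) * u⁻¹ * (v * (a - 1)⁻¹)) := by ring
    _ = _ := by rw [mul_inv_cancel₀ hpN, one_mul]
end

section
/- Let f : ℤ_p → K be uniformly differentiable with derivative f', and suppose the p-adic invariant integral I_0(f) := lim_{N→∞} p^{-N} · Σ_{x=0}^{p^N-1} f(x) exists in K (where p^{-N} denotes the inverse of p^N in K). Then I_0 of the shifted function f_1(x) := f(x+1) also exists, and I_0(f_1) = I_0(f) + f'(0). -/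
open Filter Topology

/-- `I_0(f_1) = I_0(f) + f'(0)` where `f_1(x) = f(x+1)`. -/
theorem stmt8 {p : ℕ} [Fact p.Prime] {K : Type*} [NormedField K] [CompleteSpace K]
    [IsUltrametricDist K] [Algebra ℚ_[p] K]
    (hiso : ∀ x : ℚ_[p], ‖algebraMap ℚ_[p] K x‖ = ‖x‖)
    (f f' : ℤ_[p] → K) (hf : IsUnifDiff f f')
    (I : K) (hI : HasI0 p f I) :
    HasI0 p (fun x => f (x + 1)) (I + f' 0) := by
  have hp : Tendsto (fun N : ℕ => ‖((p : ℤ_[p]) ^ N)‖) atTop (𝓝 0) := by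
    simp only [norm_pow]
    exact tendsto_pow_atTop_nhds_zero_of_lt_one (norm_nonneg _) (by rw [PadicInt.norm_p]; exact inv_lt_one_of_one_lt₀ (by exact_mod_cast (Fact.out : p.Prime).one_lt))
  have hd : Tendsto (fun N : ℕ => (f ((p : ℤ_[p]) ^ N) - f 0) / emb ((p : ℤ_[p]) ^ N))
      atTop (𝓝 (f' 0)) := by
    rw [Metric.tendsto_atTop]
    intro ε hε
    obtain ⟨δ, hδ, h⟩ := hf (ε / 2) (by positivity)
    obtain ⟨M, hM⟩ := eventually_atTop.1 (hp.eventually (ge_mem_nhds hδ))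
    refine ⟨M, fun N hN => ?_⟩
    have hp0 : (p : ℤ_[p]) ≠ 0 := by exact_mod_cast (Fact.out : p.Prime).ne_zero
    have h1 := h ((p : ℤ_[p]) ^ N) 0 (by rw [sub_zero]; exact norm_pos_iff.2 (pow_ne_zero _ hp0))
      (by rw [sub_zero]; exact hM N hN)
    rw [sub_zero] at h1
    rw [dist_eq_norm]
    linarith
  have hs := Tendsto.add hI hd
  unfold HasI0
  refine hs.congr fun N => ?_
  have e : (emb ((p : ℤ_[p]) ^ N) : K) = algebraMap ℚ_[p] K ((p : ℚ_[p]) ^ N) := by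
    simp [emb]
  have h2 := Finset.sum_range_succ (fun x : ℕ => f (x : ℤ_[p])) (p ^ N)
  have h3 := Finset.sum_range_succ' (fun x : ℕ => f (x : ℤ_[p])) (p ^ N)
  rw [h2] at h3
  push_cast at h3
  rw [e, div_eq_inv_mul, ← mul_add]
  congr 1
  linear_combination h3
end

section
/- For every continuous function g : ℤ_p → K there exists a function f : ℤ_p → K which is uniformly differentiable with derivative g. (Together with the continuity of derivatives, this expresses the isomorphism UD(ℤ_p, K)/{f : f' = 0} ≅ C(ℤ_p, K) induced by the derivative map.) -/
open Filter Topology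

lemma appr_norm_aux {p : ℕ} [Fact p.Prime] (x : ℤ_[p]) (n : ℕ) :
    ‖x - (x.appr n : ℤ_[p])‖ ≤ (p : ℝ) ^ (-(n : ℤ)) :=
  (PadicInt.norm_le_pow_iff_mem_span_pow _ n).2 (PadicInt.appr_spec n x)

lemma appr_eq_aux {p : ℕ} [Fact p.Prime] (x y : ℤ_[p]) (n : ℕ)
    (h : ‖x - y‖ ≤ (p : ℝ) ^ (-(n : ℤ))) : x.appr n = y.appr n := by
  have h1 : ‖(x.appr n : ℤ_[p]) - (y.appr n : ℤ_[p])‖ ≤ (p : ℝ) ^ (-(n : ℤ)) := by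
    have e : (x.appr n : ℤ_[p]) - (y.appr n : ℤ_[p])
        = ((x.appr n : ℤ_[p]) - x) + ((x - y) + (y - (y.appr n : ℤ_[p]))) := by ring
    rw [e]
    refine (PadicInt.nonarchimedean _ _).trans (max_le ?_ ?_)
    · rw [norm_sub_rev]; exact appr_norm_aux x n
    · exact (PadicInt.nonarchimedean _ _).trans (max_le h (appr_norm_aux y n))
  have h2 : ((p : ℤ) ^ n) ∣ ((x.appr n : ℤ) - (y.appr n : ℤ)) := by
    rw [← PadicInt.norm_int_le_pow_iff_dvd]
    push_cast
    exact h1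
  have h3 : (y.appr n) ≡ (x.appr n) [MOD p ^ n] := by
    rw [Nat.modEq_iff_dvd]
    push_cast
    exact h2
  exact (Nat.ModEq.eq_of_lt_of_lt h3 (PadicInt.appr_lt y n) (PadicInt.appr_lt x n)).symm

/-- Difference of consecutive approximations, in `K`. -/
noncomputable def dl {p : ℕ} [Fact p.Prime] (K : Type*) [NormedField K]
    [Algebra ℚ_[p] K] (x : ℤ_[p]) (n : ℕ) : K :=
  emb (x.appr (n + 1) : ℤ_[p]) - emb (x.appr n : ℤ_[p])

lemma emb_sub_aux {p : ℕ} [Fact p.Prime] {K : Type*} [NormedField K]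
    [Algebra ℚ_[p] K] (x y : ℤ_[p]) : (emb (x - y) : K) = emb x - emb y := by
  simp [emb]

/-- Every continuous `g : ℤ_p → K` is the derivative of some uniformly
differentiable `f : ℤ_p → K` (surjectivity in `UD(ℤ_p)/{f' = 0} ≅ C(ℤ_p, K)`). -/
theorem stmt10 {p : ℕ} [Fact p.Prime] {K : Type*} [NormedField K] [CompleteSpace K]
    [IsUltrametricDist K] [Algebra ℚ_[p] K]
    (hiso : ∀ x : ℚ_[p], ‖algebraMap ℚ_[p] K x‖ = ‖x‖)
    (g : ℤ_[p] → K) (hg : Continuous g) :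
    ∃ f : ℤ_[p] → K, IsUnifDiff f g := by
  have hp : (1 : ℝ) < p := by exact_mod_cast (Fact.out : p.Prime).one_lt
  have hnorm : ∀ x : ℤ_[p], ‖(emb x : K)‖ = ‖x‖ := fun x => by
    rw [emb, hiso]; exact (PadicInt.norm_def).symm
  have hzero : Tendsto (fun n : ℕ => (p : ℝ) ^ (-(n : ℤ))) atTop (𝓝 0) := by
    have := tendsto_pow_atTop_nhds_zero_of_lt_one (r := (p : ℝ)⁻¹) (by positivity)
      (inv_lt_one_of_one_lt₀ hp)
    simpa using this
  have hdl : ∀ (x : ℤ_[p]) (n : ℕ), ‖dl K x n‖ ≤ (p : ℝ) ^ (-(n : ℤ)) := fun x n => by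
    rw [dl, ← emb_sub_aux, hnorm]
    have e : (x.appr (n + 1) : ℤ_[p]) - (x.appr n : ℤ_[p])
        = ((x.appr (n + 1) : ℤ_[p]) - x) + (x - (x.appr n : ℤ_[p])) := by ring
    rw [e]
    refine (PadicInt.nonarchimedean _ _).trans (max_le ?_ (appr_norm_aux x n))
    rw [norm_sub_rev]
    refine (appr_norm_aux x (n + 1)).trans ?_
    exact zpow_le_zpow_right₀ hp.le (by push_cast; lia)
  have hsd : ∀ x : ℤ_[p], HasSum (dl K x) (emb x) := fun x => by
    have hs : Summable (dl K x) := by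
      apply NonarchimedeanAddGroup.summable_of_tendsto_cofinite_zero
      rw [Nat.cofinite_eq_atTop]
      exact squeeze_zero_norm (hdl x) hzero
    rw [hs.hasSum_iff_tendsto_nat]
    have e : ∀ n, ∑ i ∈ Finset.range n, dl K x i = emb (x.appr n : ℤ_[p]) := fun n => by
      have := Finset.sum_range_sub (fun n => (emb (x.appr n : ℤ_[p]) : K)) n
      simp only [dl]
      rw [this]
      simp [emb, PadicInt.appr]
    simp only [e]
    rw [tendsto_iff_norm_sub_tendsto_zero]
    refine squeeze_zero (fun _ => norm_nonneg _) (fun n => ?_) hzero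
    rw [← emb_sub_aux, hnorm, norm_sub_rev]
    exact appr_norm_aux x n
  obtain ⟨C, hC⟩ := (isCompact_range hg).isBounded.exists_norm_le
  have hC' : ∀ x, ‖g x‖ ≤ C := fun x => hC _ ⟨x, rfl⟩
  have hsg : ∀ x : ℤ_[p], Summable (fun n => g (x.appr n : ℤ_[p]) * dl K x n) := fun x => by
    apply NonarchimedeanAddGroup.summable_of_tendsto_cofinite_zero
    rw [Nat.cofinite_eq_atTop]
    refine squeeze_zero_norm (a := fun n : ℕ => C * (p : ℝ) ^ (-(n : ℤ))) (fun n => ?_) ?_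
    · rw [norm_mul]
      exact mul_le_mul (hC' _) (hdl x n) (norm_nonneg _) ((norm_nonneg _).trans (hC' 0))
    · simpa using hzero.const_mul C
  refine ⟨fun x => ∑' n, g (x.appr n : ℤ_[p]) * dl K x n, ?_⟩
  intro ε hε
  have huc := CompactSpace.uniformContinuous_of_continuous hg
  rw [Metric.uniformContinuous_iff] at huc
  obtain ⟨δ, hδ, H⟩ := huc ε hε
  refine ⟨δ / 2, by positivity, fun x y hxy hle => ?_⟩
  have hs : ∀ z : ℤ_[p], HasSum (fun n => (g (z.appr n : ℤ_[p]) - g y) * dl K z n)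
      ((∑' n, g (z.appr n : ℤ_[p]) * dl K z n) - g y * emb z) := fun z => by
    have := (hsg z).hasSum.sub ((hsd z).mul_left (g y))
    simpa only [sub_mul] using this
  have key := (hs x).sub (hs y)
  have hne : (emb (x - y) : K) ≠ 0 := by
    rw [← norm_pos_iff, hnorm]; exact hxy
  have hterm : ∀ n : ℕ, ‖x - y‖ > (p : ℝ) ^ (-((n + 1 : ℕ) : ℤ)) → ∀ z : ℤ_[p], ‖z - y‖ ≤ ‖x - y‖ →
      ‖(g (z.appr n : ℤ_[p]) - g y) * dl K z n‖ ≤ ε * ‖x - y‖ := fun n hn z hz => by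
    have hn' : (p : ℝ) ^ (-(n : ℤ)) ≤ ‖x - y‖ := by
      by_contra! hlt
      have e : (-(n : ℤ)) = -((n + 1 : ℕ) : ℤ) + 1 := by push_cast; ring
      rw [e, ← PadicInt.norm_le_pow_iff_norm_lt_pow_add_one] at hlt
      exact absurd hlt (not_le.2 hn)
    rw [norm_mul]
    refine mul_le_mul ?_ ((hdl z n).trans hn') (norm_nonneg _) hε.le
    have : dist (z.appr n : ℤ_[p]) y < δ := by
      rw [dist_eq_norm]
      have e : (z.appr n : ℤ_[p]) - y = ((z.appr n : ℤ_[p]) - z) + (z - y) := by ring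
      have : ‖(z.appr n : ℤ_[p]) - y‖ ≤ ‖x - y‖ := by
        rw [e]
        refine (PadicInt.nonarchimedean _ _).trans (max_le ?_ hz)
        rw [norm_sub_rev]
        exact (appr_norm_aux z n).trans hn'
      linarith
    have := H this
    rw [dist_eq_norm] at this
    exact this.le
  have hb : ‖((∑' n, g (x.appr n : ℤ_[p]) * dl K x n) - g y * emb x)
      - ((∑' n, g (y.appr n : ℤ_[p]) * dl K y n) - g y * emb y)‖ ≤ ε * ‖x - y‖ := by
    rw [← key.tsum_eq]
    refine IsUltrametricDist.norm_tsum_le_of_forall_le_of_nonneg (by positivity) fun n => ?_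
    by_cases hn : ‖x - y‖ ≤ (p : ℝ) ^ (-((n + 1 : ℕ) : ℤ))
    · have e1 := appr_eq_aux x y (n + 1) hn
      have e0 := appr_eq_aux x y n (hn.trans (zpow_le_zpow_right₀ hp.le (by push_cast; lia)))
      simp only [dl, e1, e0, sub_self, norm_zero]
      positivity
    · push Not at hn
      rw [sub_eq_add_neg]
      refine (IsUltrametricDist.norm_add_le_max _ _).trans (max_le (hterm n hn x le_rfl) ?_)
      rw [norm_neg]
      exact hterm n hn y (by simp)
  rw [div_sub' hne, norm_div, hnorm, div_le_iff₀ hxy]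
  refine le_trans (le_of_eq ?_) hb
  rw [emb_sub_aux]
  congr 1
  ring
end
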